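/- Let f, g_1, …, g_m ∈ ℝ[x] with g = (g_1,…,g_m) and f* := inf{f(x) : x ∈ S(g)}. Assume that f attains a global minimizer on S(g) and that f(C(g)) := {f(x) : x ∈ C(g)} is a finite set. Then there exists k ∈ ℕ such that ρ_k(f, Πg, h_FJ) = f*. Moreover, if S(g) satisfies the Archimedean condition, then there exists k ∈ ℕ such that ρ_k(f, g, h_FJ) = f*. -/

import Mathlib

open MvPolynomial

noncomputable section

/-- `p` is a sum of squares of polynomials. -/
def IsSOS {σ : Type*} (p : MvPolynomial σ ℝ) : Prop :=
  ∃ (k : ℕ) (q : Fin k → MvPolynomial σ ℝ), p = ∑ i, q i ^ 2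

/-- Membership in the quadratic module `Q(g)` generated by the tuple `g`. -/
def InQM {σ ι : Type*} [Fintype ι] (g : ι → MvPolynomial σ ℝ) (p : MvPolynomial σ ℝ) : Prop :=
  ∃ (s0 : MvPolynomial σ ℝ) (s : ι → MvPolynomial σ ℝ),
    IsSOS s0 ∧ (∀ j, IsSOS (s j)) ∧ p = s0 + ∑ j, s j * g j

/-- Membership in the truncated quadratic module `Q_k(g)` of order `k`. -/
def InTruncQM {σ ι : Type*} [Fintype ι] (k : ℕ) (g : ι → MvPolynomial σ ℝ)
    (p : MvPolynomial σ ℝ) : Prop :=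
  ∃ (s0 : MvPolynomial σ ℝ) (s : ι → MvPolynomial σ ℝ),
    IsSOS s0 ∧ (∀ j, IsSOS (s j)) ∧ s0.totalDegree ≤ 2 * k ∧
    (∀ j, (s j * g j).totalDegree ≤ 2 * k) ∧ p = s0 + ∑ j, s j * g j

/-- Membership in the truncated ideal `I_k(h)` of order `k`. -/
def InTruncId {σ ι : Type*} [Fintype ι] (k : ℕ) (h : ι → MvPolynomial σ ℝ)
    (p : MvPolynomial σ ℝ) : Prop :=
  ∃ ps : ι → MvPolynomial σ ℝ, (∀ t, (ps t * h t).totalDegree ≤ 2 * k) ∧ p = ∑ t, ps t * h t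

/-- The value `ρ_k(f, g, h)` of the SOS relaxation of order `k`. -/
def rho {σ ι κ : Type*} [Fintype ι] [Fintype κ] (k : ℕ) (f : MvPolynomial σ ℝ)
    (g : ι → MvPolynomial σ ℝ) (h : κ → MvPolynomial σ ℝ) : ℝ :=
  sSup {ξ : ℝ | ∃ q1 q2, InTruncQM k g q1 ∧ InTruncId k h q2 ∧ f - C ξ = q1 + q2}

/-- The basic semi-algebraic set `S(g)`. -/
def Sg {n m : ℕ} (g : Fin m → MvPolynomial (Fin n) ℝ) : Set (Fin n → ℝ) :=
  {x | ∀ j, 0 ≤ eval x (g j)}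

/-- `S(g)` satisfies the Archimedean condition. -/
def ArchCond {n m : ℕ} (g : Fin m → MvPolynomial (Fin n) ℝ) : Prop :=
  ∃ R : ℝ, 0 < R ∧ InQM g (C R - ∑ i : Fin n, X i ^ 2)

/-- The set of critical points `C(g)`. -/
def Cset {n m : ℕ} (g : Fin m → MvPolynomial (Fin n) ℝ) : Set (Fin n → ℝ) :=
  {x | ∃ lam : Fin m → ℝ, lam ≠ 0 ∧
    (∀ i, ∑ j, lam j * eval x (pderiv i (g j)) = 0) ∧
    (∀ j, lam j * eval x (g j) = 0)}

/-- The Fritz John polynomial system `h_FJ`, a tuple of `n + m + 1` polynomials in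
`ℝ[x, λ̄]`, where the `x` variables are `Sum.inl`-indexed and the `λ̄ = (λ₀, …, λ_m)`
variables are `Sum.inr`-indexed. -/
def hFJ {n m : ℕ} (f : MvPolynomial (Fin n) ℝ) (g : Fin m → MvPolynomial (Fin n) ℝ) :
    Fin n ⊕ (Fin m ⊕ Unit) → MvPolynomial (Fin n ⊕ Fin (m + 1)) ℝ
  | Sum.inl i => X (Sum.inr 0) * rename Sum.inl (pderiv i f)
      - ∑ j : Fin m, X (Sum.inr j.succ) * rename Sum.inl (pderiv i (g j))
  | Sum.inr (Sum.inl j) => X (Sum.inr j.succ) * rename Sum.inl (g j)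
  | Sum.inr (Sum.inr _) => 1 - ∑ j : Fin (m + 1), X (Sum.inr j) ^ 2

/-- The tuple `Πg` of all nontrivial products of entries of `g`, viewed in `ℝ[x, λ̄]`. -/
def PiG {n m : ℕ} (g : Fin m → MvPolynomial (Fin n) ℝ) :
    {A : Finset (Fin m) // A.Nonempty} → MvPolynomial (Fin n ⊕ Fin (m + 1)) ℝ :=
  fun A => rename Sum.inl (∏ j ∈ A.1, g j)

set_option linter.unusedSectionVars false

/-- The intermediate value property for polynomials over an ordered field. -/
def PolyIVT (F : Type*) [Field F] [LinearOrder F] : Prop :=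
  ∀ (p : Polynomial F) (a b : F), a < b → p.eval a * p.eval b < 0 →
    ∃ c, a < c ∧ c < b ∧ p.eval c = 0

section PolyIVT

variable {F : Type*} [Field F] [LinearOrder F] [IsStrictOrderedRing F]

lemma PolyIVT.mul_eval_pos (hF : PolyIVT F) {p : Polynomial F} {a b : F} (hab : a ≤ b)
    (ha : p.eval a ≠ 0) (hb : p.eval b ≠ 0) (h : ∀ c, a < c → c < b → p.eval c ≠ 0) :
    0 < p.eval a * p.eval b := by
  rcases hab.eq_or_lt with rfl | hab
  · exact mul_self_pos.2 ha
  by_contra hn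
  obtain ⟨c, h1, h2, h3⟩ := hF p a b hab (lt_of_le_of_ne (not_lt.1 hn) (mul_ne_zero ha hb))
  exact h c h1 h2 h3

open Polynomial in
lemma PolyIVT.exists_derivative_root (hF : PolyIVT F) {p : Polynomial F} (hp : p ≠ 0) {a b : F}
    (hab : a < b) (ha : p.eval a = 0) (hb : p.eval b = 0) :
    ∃ c, a ≤ c ∧ c ≤ b ∧ p.derivative.eval c = 0 := by
  classical
  set s := p.roots.toFinset.filter (fun c => a < c) with hs
  have hsn : s.Nonempty := ⟨b, by simp [hs, hp, hb, hab]⟩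
  set b' := s.min' hsn with hb'
  have hb's : b' ∈ s := s.min'_mem hsn
  have hb'' : p.eval b' = 0 ∧ a < b' := by simpa [hs, hp] using hb's
  have hle : b' ≤ b := s.min'_le b (by simp [hs, hp, hb, hab])
  have hnone : ∀ c, a < c → c < b' → p.eval c ≠ 0 := fun c h1 h2 h3 =>
    absurd (s.min'_le c (by simp [hs, hp, h3, h1])) (not_le.2 h2)
  obtain ⟨q, hq⟩ := dvd_iff_isRoot.2 (show p.IsRoot a from ha)
  have hqb : q.eval b' = 0 := by
    have h := hb''.1
    rw [hq] at h
    simpa [sub_eq_zero, hb''.2.ne'] using h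
  obtain ⟨r, hr⟩ := dvd_iff_isRoot.2 (show q.IsRoot b' from hqb)
  have hder : ∀ c, p.derivative.eval c =
      (c - b') * r.eval c + (c - a) * r.eval c + (c - a) * (c - b') * r.derivative.eval c := by
    intro c
    rw [hq, hr]
    simp [derivative_mul]
    ring
  by_cases hra : r.eval a = 0
  · exact ⟨a, le_rfl, hab.le, by simp [hder, hra]⟩
  by_cases hrb : r.eval b' = 0
  · exact ⟨b', hb''.2.le, hle, by simp [hder, hrb]⟩
  have hpos := hF.mul_eval_pos hb''.2.le hra hrb (fun c h1 h2 h3 =>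
    hnone c h1 h2 (by rw [hq, hr]; simp [h3]))
  obtain ⟨c, h1, h2, h3⟩ := hF p.derivative a b' hb''.2 (by
    rw [hder, hder]
    have : 0 < (b' - a) * (b' - a) := mul_self_pos.2 (sub_ne_zero.2 hb''.2.ne')
    nlinarith [mul_pos this hpos])
  exact ⟨c, h1.le, h2.le.trans hle, h3⟩

/-- A simple root of a polynomial isolated by critical points is a sign change. -/
lemma PolyIVT.mul_eval_neg (hF : PolyIVT F) {p : Polynomial F} {a b y : F} (hay : a < y)
    (hyb : y < b) (hy : p.eval y = 0) (ha : p.eval a ≠ 0) (hb : p.eval b ≠ 0)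
    (h : ∀ c, a < c → c < b → p.derivative.eval c ≠ 0) :
    p.eval a * p.eval b < 0 := by
  have hp : p ≠ 0 := by rintro rfl; simp at ha
  obtain ⟨q, hq⟩ := Polynomial.dvd_iff_isRoot.2 (show p.IsRoot y from hy)
  have hqe : ∀ c, p.eval c = (c - y) * q.eval c := fun c => by rw [hq]; simp
  have hqa : q.eval a ≠ 0 := fun h0 => ha (by simp [hqe, h0])
  have hqb : q.eval b ≠ 0 := fun h0 => hb (by simp [hqe, h0])
  have hpos := hF.mul_eval_pos (hay.trans hyb).le hqa hqb (fun c h1 h2 h3 => by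
    have hc : p.eval c = 0 := by simp [hqe, h3]
    rcases lt_trichotomy c y with hcy | rfl | hcy
    · obtain ⟨w, hw1, hw2, hw3⟩ := hF.exists_derivative_root hp hcy hc hy
      exact h w (h1.trans_le hw1) (hw2.trans_lt hyb) hw3
    · apply h c hay hyb
      rw [hq]
      simp [Polynomial.derivative_mul, h3]
    · obtain ⟨w, hw1, hw2, hw3⟩ := hF.exists_derivative_root hp hcy hy hc
      exact h w (hay.trans_le hw1) (hw2.trans_lt h2) hw3)
  rw [hqe, hqe]
  have : 0 < (y - a) * (b - y) := mul_pos (sub_pos.2 hay) (sub_pos.2 hyb)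
  nlinarith [mul_pos this hpos]

/-- A root of a monic polynomial is bounded by a polynomial expression in the coefficients. -/
lemma Polynomial.Monic.abs_root_lt {p : Polynomial F} (hp : p.Monic) {y : F}
    (hy : p.eval y = 0) : |y| < 1 + ∑ i ∈ Finset.range p.natDegree, (1 + p.coeff i ^ 2) := by
  by_contra! hM
  set d := p.natDegree with hd
  have hsum : 0 ≤ ∑ i ∈ Finset.range d, (1 + p.coeff i ^ 2) :=
    Finset.sum_nonneg fun i _ => by positivity
  have hy1 : 1 ≤ |y| := by linarith
  have hd0 : d ≠ 0 := by
    intro h0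
    have := hp.natDegree_eq_zero.1 (hd ▸ h0)
    simp [this] at hy
  obtain ⟨e, he⟩ := Nat.exists_eq_succ_of_ne_zero hd0
  rw [Polynomial.eval_eq_sum_range, Finset.sum_range_succ, ← hd, hp.coeff_natDegree, one_mul] at hy
  have h1 : |y| ^ d ≤ ∑ i ∈ Finset.range d, (1 + p.coeff i ^ 2) * |y| ^ e := by
    rw [← abs_pow, eq_neg_of_add_eq_zero_right hy, abs_neg]
    refine (Finset.abs_sum_le_sum_abs _ _).trans (Finset.sum_le_sum fun i hi => ?_)
    rw [abs_mul, abs_pow]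
    have hi' : i ≤ e := by rw [Finset.mem_range] at hi; omega
    have h2 : |p.coeff i| ≤ 1 + p.coeff i ^ 2 := by
      rw [← sq_abs]; nlinarith [sq_nonneg (|p.coeff i| - 1), abs_nonneg (p.coeff i)]
    exact mul_le_mul h2 (pow_le_pow_right₀ hy1 hi') (by positivity) (by positivity)
  rw [← Finset.sum_mul, he, Nat.succ_eq_add_one, pow_succ, mul_comm] at h1
  have h3 : 0 < |y| ^ e := by positivity
  have := le_of_mul_le_mul_right h1 h3
  rw [← Nat.succ_eq_add_one, ← he] at this
  linarith

end PolyIVT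

section SignCompat

variable {K L : Type*} [Field K] [LinearOrder K] [IsStrictOrderedRing K]
  [Field L] [LinearOrder L] [IsStrictOrderedRing L]

/-- A subring of `K × L` on which both projections have the same sign: an isomorphism between
ordered subrings of `K` and `L`. -/
def SignCompat (S : Subring (K × L)) : Prop :=
  ∀ a b, (a, b) ∈ S → (0 < a ↔ 0 < b)

/-- A pair of polynomials whose coefficients correspond to each other under `S`. -/
def PolyPair (S : Subring (K × L)) (p : Polynomial K) (q : Polynomial L) : Prop :=
  ∀ i, (p.coeff i, q.coeff i) ∈ S

variable {S : Subring (K × L)}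

lemma pair_sub_mem {a b : K} {a' b' : L} (h : (a, a') ∈ S) (h' : (b, b') ∈ S) :
    (a - b, a' - b') ∈ S := S.sub_mem h h'

lemma pair_add_mem {a b : K} {a' b' : L} (h : (a, a') ∈ S) (h' : (b, b') ∈ S) :
    (a + b, a' + b') ∈ S := S.add_mem h h'

lemma pair_mul_mem {a b : K} {a' b' : L} (h : (a, a') ∈ S) (h' : (b, b') ∈ S) :
    (a * b, a' * b') ∈ S := S.mul_mem h h'

lemma pair_neg_mem {a : K} {a' : L} (h : (a, a') ∈ S) : (-a, -a') ∈ S := S.neg_mem h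

lemma pair_one_mem : ((1 : K), (1 : L)) ∈ S := S.one_mem

lemma pair_zero_mem : ((0 : K), (0 : L)) ∈ S := S.zero_mem

namespace SignCompat

lemma neg_iff (hS : SignCompat S) {a : K} {b : L} (h : (a, b) ∈ S) : a < 0 ↔ b < 0 := by
  simpa using hS _ _ (pair_neg_mem h)

lemma eq_zero_iff (hS : SignCompat S) {a : K} {b : L} (h : (a, b) ∈ S) : a = 0 ↔ b = 0 := by
  have h1 := hS _ _ h
  have h2 := hS.neg_iff h
  constructor
  · rintro rfl
    exact le_antisymm (by simpa using h1) (by simpa using h2)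
  · rintro rfl
    exact le_antisymm (by simpa using h1) (by simpa using h2)

lemma lt_iff (hS : SignCompat S) {a b : K} {a' b' : L} (h : (a, a') ∈ S) (h' : (b, b') ∈ S) :
    a < b ↔ a' < b' := by
  simpa using hS _ _ (pair_sub_mem h' h)

lemma snd_unique (hS : SignCompat S) {a : K} {b b' : L} (h : (a, b) ∈ S) (h' : (a, b') ∈ S) :
    b = b' := by
  have := (hS.eq_zero_iff (pair_sub_mem h h')).1 (sub_self a)
  exact sub_eq_zero.1 this

end SignCompat

/-- Exchange of the two factors. -/
def swapSubring (S : Subring (K × L)) : Subring (L × K) :=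
  S.comap (RingEquiv.prodComm : L × K ≃+* K × L).toRingHom

lemma SignCompat.swap (hS : SignCompat S) : SignCompat (swapSubring S) :=
  fun a b h => (hS b a h).symm

lemma maximal_swap (hS : Maximal SignCompat S) : Maximal SignCompat (swapSubring S) := by
  refine ⟨hS.1.swap, fun T hT hle => ?_⟩
  have h1 : S ≤ swapSubring T := fun x hx => hle (show (x.2, x.1) ∈ swapSubring S from hx)
  exact fun x hx => hS.2 hT.swap h1 (show (x.2, x.1) ∈ swapSubring T from hx)

namespace PolyPair

variable {p p' : Polynomial K} {q q' : Polynomial L}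

lemma swap (h : PolyPair S p q) : PolyPair (swapSubring S) q p := h

/-- The polynomial over `S` given by a pair of polynomials. -/
lemma exists_lift (h : PolyPair S p q) : ∃ P : Polynomial S,
    P.map ((RingHom.fst K L).comp S.subtype) = p ∧
    P.map ((RingHom.snd K L).comp S.subtype) = q := by
  refine ⟨∑ i ∈ Finset.range (max p.natDegree q.natDegree + 1),
    Polynomial.monomial i ⟨(p.coeff i, q.coeff i), h i⟩, ?_, ?_⟩
  · conv_rhs => rw [p.as_sum_range' (max p.natDegree q.natDegree + 1) (by omega)]
    simp [Polynomial.map_sum]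
  · conv_rhs => rw [q.as_sum_range' (max p.natDegree q.natDegree + 1) (by omega)]
    simp [Polynomial.map_sum]

lemma of_map (P : Polynomial S) : PolyPair S (P.map ((RingHom.fst K L).comp S.subtype))
    (P.map ((RingHom.snd K L).comp S.subtype)) := by
  intro i
  simp only [Polynomial.coeff_map]
  exact (P.coeff i).2

lemma eval_mem (h : PolyPair S p q) {a : K} {b : L} (hab : (a, b) ∈ S) :
    (p.eval a, q.eval b) ∈ S := by
  obtain ⟨P, rfl, rfl⟩ := h.exists_lift
  have : ((P.map ((RingHom.fst K L).comp S.subtype)).eval a,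
      (P.map ((RingHom.snd K L).comp S.subtype)).eval b) = (P.eval ⟨(a, b), hab⟩ : S) := by
    have h1 := Polynomial.eval_map_apply ((RingHom.fst K L).comp S.subtype) (p := P) ⟨(a, b), hab⟩
    have h2 := Polynomial.eval_map_apply ((RingHom.snd K L).comp S.subtype) (p := P) ⟨(a, b), hab⟩
    exact Prod.ext h1 h2
  rw [this]
  exact Subtype.coe_prop _

lemma mul (h : PolyPair S p q) (h' : PolyPair S p' q') : PolyPair S (p * p') (q * q') := by
  obtain ⟨P, rfl, rfl⟩ := h.exists_lift
  obtain ⟨P', rfl, rfl⟩ := h'.exists_lift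
  rw [← Polynomial.map_mul, ← Polynomial.map_mul]
  exact of_map _

lemma neg (h : PolyPair S p q) : PolyPair S (-p) (-q) := fun i => by
  simpa using pair_neg_mem (h i)

lemma derivative (h : PolyPair S p q) : PolyPair S p.derivative q.derivative := by
  obtain ⟨P, rfl, rfl⟩ := h.exists_lift
  rw [Polynomial.derivative_map, Polynomial.derivative_map]
  exact of_map _

lemma C {a : K} {b : L} (h : (a, b) ∈ S) : PolyPair S (Polynomial.C a) (Polynomial.C b) := by
  intro i
  rcases i with _ | i
  · simpa using h
  · simpa [Polynomial.coeff_C] using pair_zero_mem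

lemma X_sub_C {a : K} {b : L} (h : (a, b) ∈ S) :
    PolyPair S (Polynomial.X - Polynomial.C a) (Polynomial.X - Polynomial.C b) := by
  have : PolyPair S (Polynomial.X : Polynomial K) (Polynomial.X : Polynomial L) := by
    simpa using of_map (S := S) Polynomial.X
  exact fun i => by simpa using pair_sub_mem (this i) (C h i)

lemma eq_zero_iff (hS : SignCompat S) (h : PolyPair S p q) : p = 0 ↔ q = 0 := by
  simp only [Polynomial.ext_iff, Polynomial.coeff_zero]
  exact forall_congr' fun i => hS.eq_zero_iff (h i)

lemma natDegree_eq (hS : SignCompat S) (h : PolyPair S p q) : p.natDegree = q.natDegree := by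
  apply le_antisymm
  · exact Polynomial.natDegree_le_iff_coeff_eq_zero.2 fun i hi =>
      (hS.eq_zero_iff (h i)).2 (Polynomial.coeff_eq_zero_of_natDegree_lt hi)
  · exact Polynomial.natDegree_le_iff_coeff_eq_zero.2 fun i hi =>
      (hS.eq_zero_iff (h i)).1 (Polynomial.coeff_eq_zero_of_natDegree_lt hi)

lemma monic (hS : SignCompat S) (h : PolyPair S p q) (hp : p.Monic) : q.Monic := by
  have h1 := h p.natDegree
  rw [hp.coeff_natDegree, h.natDegree_eq hS] at h1
  exact (hS.snd_unique pair_one_mem h1).symm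

lemma divModByMonic (hS : SignCompat S) (h : PolyPair S p q) (h' : PolyPair S p' q')
    (hp : p'.Monic) : PolyPair S (p /ₘ p') (q /ₘ q') ∧ PolyPair S (p %ₘ p') (q %ₘ q') := by
  obtain ⟨P, rfl, rfl⟩ := h.exists_lift
  obtain ⟨P', rfl, rfl⟩ := h'.exists_lift
  have hinj : Function.Injective ((RingHom.fst K L).comp S.subtype) := by
    rw [injective_iff_map_eq_zero]
    rintro ⟨⟨a, b⟩, hab⟩ h0
    have h0' : a = 0 := h0
    have := (hS.eq_zero_iff hab).1 h0'
    subst this h0'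
    rfl
  have hP' : P'.Monic := Polynomial.monic_of_injective hinj hp
  rw [← Polynomial.map_divByMonic _ hP', ← Polynomial.map_divByMonic _ hP',
    ← Polynomial.map_modByMonic _ hP', ← Polynomial.map_modByMonic _ hP']
  exact ⟨of_map _, of_map _⟩

end PolyPair

/-- The criterion for adjoining a pair to a sign compatible subring. -/
lemma mem_of_maximal_signCompat (hS : Maximal SignCompat S) {y : K} {z : L}
    (h : ∀ p q, PolyPair S p q → 0 < p.eval y → 0 < q.eval z)
    (h' : ∀ p q, PolyPair S p q → p.eval y = 0 → q.eval z = 0) : (y, z) ∈ S := by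
  set T : Subring (K × L) := (Polynomial.eval₂RingHom S.subtype (y, z)).range with hT
  have hev : ∀ P : Polynomial S, Polynomial.eval₂ S.subtype (y, z) P =
      ((P.map ((RingHom.fst K L).comp S.subtype)).eval y,
        (P.map ((RingHom.snd K L).comp S.subtype)).eval z) := by
    intro P
    rw [Polynomial.eval_map, Polynomial.eval_map]
    exact Prod.ext (Polynomial.hom_eval₂ P S.subtype (RingHom.fst K L) (y, z))
      (Polynomial.hom_eval₂ P S.subtype (RingHom.snd K L) (y, z))
  have hTc : SignCompat T := by
    rintro a b ⟨P, hP⟩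
    rw [Polynomial.coe_eval₂RingHom, hev, Prod.mk.injEq] at hP
    obtain ⟨rfl, rfl⟩ := hP
    have hpair := PolyPair.of_map P
    refine ⟨h _ _ hpair, fun hpos => ?_⟩
    by_contra hn
    rcases (not_lt.1 hn).lt_or_eq with hlt | heq
    · have := h _ _ hpair.neg (by simpa using hlt)
      simp only [Polynomial.eval_neg, Left.neg_pos_iff] at this
      exact absurd this (not_lt.2 hpos.le)
    · exact hpos.ne' (h' _ _ hpair heq)
  have hle : S ≤ T := fun s hs => ⟨Polynomial.C ⟨s, hs⟩, by simp⟩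
  exact hS.2 hTc hle ⟨Polynomial.X, by simp⟩

lemma exists_maximal_signCompat (hS : SignCompat S) : ∃ T, S ≤ T ∧ Maximal SignCompat T := by
  refine zorn_le_nonempty₀ {T : Subring (K × L) | SignCompat T} (fun c hc hchain T hT => ?_) S hS
  refine ⟨sSup c, ?_, fun s hs => le_sSup hs⟩
  intro a b hab
  rw [Subring.mem_sSup_of_directedOn ⟨T, hT⟩ hchain.directedOn] at hab
  obtain ⟨s, hs, hab⟩ := hab
  exact hc hs a b hab

lemma eval_inv_mul_pow_natDegree {F : Type*} [Field F] (r : Polynomial F) {c : F} (hc : c ≠ 0) :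
    r.eval c⁻¹ * c ^ r.natDegree = r.reverse.eval c := by
  let _ := invertibleOfNonzero (inv_ne_zero hc)
  have := Polynomial.eval₂_reverse_mul_pow (RingHom.id F) c⁻¹ r
  simp only [invOf_eq_inv, inv_inv, Polynomial.eval₂_id] at this
  rw [← this, mul_assoc, ← mul_pow, inv_mul_cancel₀ hc, one_pow, mul_one]

lemma inv_mem_of_maximal (hS : Maximal SignCompat S) {a : K} {b : L} (h : (a, b) ∈ S) :
    (a⁻¹, b⁻¹) ∈ S := by
  by_cases ha : a = 0
  · have hb := (hS.1.eq_zero_iff h).1 ha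
    subst ha hb
    simpa using pair_zero_mem (S := S)
  have hb : b ≠ 0 := fun hb => ha ((hS.1.eq_zero_iff h).2 hb)
  have key : ∀ p q, PolyPair S p q →
      (p.eval a⁻¹ * (a ^ p.natDegree * a ^ p.natDegree),
        q.eval b⁻¹ * (b ^ p.natDegree * b ^ p.natDegree)) ∈ S := by
    intro p q hpq
    have hrev : PolyPair S p.reverse q.reverse := by
      intro i
      rw [Polynomial.coeff_reverse, Polynomial.coeff_reverse, hpq.natDegree_eq hS.1]
      exact hpq _
    have hpow : (a ^ p.natDegree, b ^ p.natDegree) ∈ S := S.pow_mem h _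
    have := pair_mul_mem (hrev.eval_mem h) hpow
    rw [← eval_inv_mul_pow_natDegree p ha, ← eval_inv_mul_pow_natDegree q hb,
      ← hpq.natDegree_eq hS.1, mul_assoc, mul_assoc] at this
    exact this
  have hpa : ∀ n, 0 < a ^ n * a ^ n := fun n => mul_self_pos.2 (pow_ne_zero _ ha)
  have hpb : ∀ n, 0 < b ^ n * b ^ n := fun n => mul_self_pos.2 (pow_ne_zero _ hb)
  refine mem_of_maximal_signCompat hS (fun p q hpq hpos => ?_) (fun p q hpq h0 => ?_)
  · exact (mul_pos_iff_of_pos_right (hpb _)).1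
      ((hS.1 _ _ (key p q hpq)).1 (mul_pos hpos (hpa _)))
  · have := (hS.1.eq_zero_iff (key p q hpq)).1 (by rw [h0, zero_mul])
    exact (mul_eq_zero.1 this).resolve_right (hpb _).ne'

end SignCompat

lemma PolyIVT.eval_pos_of_eval_pos {F : Type*} [Field F] [LinearOrder F] [IsStrictOrderedRing F]
    (hF : PolyIVT F) {p : Polynomial F} {a b u v : F} (h : ∀ c, a < c → c < b → p.eval c ≠ 0)
    (hau : a < u) (hub : u < b) (hav : a < v) (hvb : v < b) (hpos : 0 < p.eval u) :
    0 < p.eval v := by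
  rcases le_total u v with huv | huv
  · exact (mul_pos_iff_of_pos_left hpos).1 (hF.mul_eval_pos huv (h _ hau hub) (h _ hav hvb)
      fun c h3 h4 => h c (hau.trans h3) (h4.trans hvb))
  · exact (mul_pos_iff_of_pos_right hpos).1 (hF.mul_eval_pos huv (h _ hav hvb) (h _ hau hub)
      fun c h3 h4 => h c (hav.trans h3) (h4.trans hub))

section AlgebraicStep

variable {K L : Type*} [Field K] [LinearOrder K] [IsStrictOrderedRing K]
  [Field L] [LinearOrder L] [IsStrictOrderedRing L] {S : Subring (K × L)}

/-- Every root in `K` of a nonzero polynomial over `S` of degree less than `d` lies in `S`. -/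
def FstRoots (S : Subring (K × L)) (d : ℕ) : Prop :=
  ∀ p q, PolyPair S p q → p ≠ 0 → p.natDegree < d → ∀ y, p.eval y = 0 → ∃ z, (y, z) ∈ S

lemma exists_pair_near (R : Finset K)
    (hR : ∀ r ∈ R, ∃ r', (r, r') ∈ S) {y : K} (hy : ∀ z, (y, z) ∉ S) {b b' : K}
    (hb : b ∈ R) (hb' : b' ∈ R) (hby : b < y) (hyb : y < b') :
    ∃ c₁ c₂ : K × L, c₁ ∈ S ∧ c₂ ∈ S ∧ c₁.1 < y ∧ y < c₂.1 ∧
      ∀ r ∈ R, c₁.1 < r → r < c₂.1 → False := by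
  have h1 : (R.filter (· < y)).Nonempty := ⟨b, by simp [hb, hby]⟩
  have h2 : (R.filter (y < ·)).Nonempty := ⟨b', by simp [hb', hyb]⟩
  have m1 := Finset.mem_filter.1 (Finset.max'_mem _ h1)
  have m2 := Finset.mem_filter.1 (Finset.min'_mem _ h2)
  obtain ⟨c1, hc1⟩ := hR _ m1.1
  obtain ⟨c2, hc2⟩ := hR _ m2.1
  refine ⟨_, _, hc1, hc2, m1.2, m2.2, fun r hr h3 h4 => ?_⟩
  rcases lt_trichotomy r y with h | h | h
  · exact absurd (Finset.le_max' _ r (Finset.mem_filter.2 ⟨hr, h⟩)) (not_le.2 h3)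
  · obtain ⟨r', hr'⟩ := hR r hr
    exact hy r' (h ▸ hr')
  · exact absurd (Finset.min'_le _ r (Finset.mem_filter.2 ⟨hr, h⟩)) (not_le.2 h4)

lemma exists_matching_root (hK : PolyIVT K) (hL : PolyIVT L) (hS : Maximal SignCompat S)
    {p : Polynomial K} {q : Polynomial L} (hpq : PolyPair S p q) (hp : p.Monic)
    (h1 : FstRoots S p.natDegree) (h2 : FstRoots (swapSubring S) p.natDegree)
    {y : K} (hy : p.eval y = 0) (hyS : ∀ z, (y, z) ∉ S)
    (G : Finset (Polynomial K × Polynomial L))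
    (hG : ∀ r ∈ G, PolyPair S r.1 r.2 ∧ r.1 ≠ 0 ∧ r.1.natDegree < p.natDegree) :
    ∃ z, q.eval z = 0 ∧ ∀ r ∈ G, (0 < r.1.eval y ↔ 0 < r.2.eval z) := by
  classical
  have hd : 0 < p.natDegree := by
    rw [Nat.pos_iff_ne_zero]
    intro h0
    simp [hp.natDegree_eq_zero.1 h0] at hy
  have hlow : ∀ r t, PolyPair S r t → r ≠ 0 → r.natDegree < p.natDegree → r.eval y ≠ 0 := by
    intro r t hrt hr hdeg h0
    obtain ⟨z, hz⟩ := h1 r t hrt hr hdeg y h0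
    exact hyS z hz
  have hder0 : p.derivative ≠ 0 := by
    intro h0
    have := Polynomial.derivative_eq_zero.1 h0
    omega
  have hderd : p.derivative.natDegree < p.natDegree := Polynomial.natDegree_derivative_lt hd.ne'
  have hp0 : p ≠ 0 := hp.ne_zero
  have hroot : ∀ c c', (c, c') ∈ S → p.eval c ≠ 0 := by
    intro c c' hc h0
    have hdiv := Polynomial.mul_divByMonic_eq_iff_isRoot.2 (show p.IsRoot c from h0)
    have hpair := (hpq.divModByMonic hS.1 (PolyPair.X_sub_C hc) (Polynomial.monic_X_sub_C c)).1
    have hyc : y ≠ c := by rintro rfl; exact hyS _ hc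
    refine hlow _ _ hpair ?_ ?_ ?_
    · intro h; rw [h, mul_zero] at hdiv; exact hp0 hdiv.symm
    · rw [Polynomial.natDegree_divByMonic _ (Polynomial.monic_X_sub_C c),
        Polynomial.natDegree_X_sub_C]
      omega
    · rw [← hdiv] at hy
      simpa [sub_eq_zero, hyc] using hy
  -- an interval around `y` free of critical points of `p` and of roots of the members of `G`
  set M := 1 + ∑ i ∈ Finset.range p.natDegree, (1 + p.coeff i ^ 2) with hM
  set M' := 1 + ∑ i ∈ Finset.range p.natDegree, (1 + q.coeff i ^ 2) with hM'
  have hMS : (M, M') ∈ S := by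
    have : ((M, M') : K × L) =
        1 + ∑ i ∈ Finset.range p.natDegree, (1 + (p.coeff i, q.coeff i) ^ 2) := by
      ext <;> simp [hM, hM', Prod.fst_sum, Prod.snd_sum]
    rw [this]
    exact S.add_mem S.one_mem (S.sum_mem fun i _ => S.add_mem S.one_mem (S.pow_mem (hpq i) 2))
  obtain ⟨hMy, hyM⟩ := abs_lt.1 (hp.abs_root_lt hy)
  set R : Finset K := {-M, M} ∪ (p.derivative.roots.toFinset ∪
    G.biUnion fun r => r.1.roots.toFinset) with hR
  have hRS : ∀ r ∈ R, ∃ r', (r, r') ∈ S := by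
    intro r hr
    simp only [hR, Finset.mem_union, Finset.mem_insert, Finset.mem_singleton, Multiset.mem_toFinset,
      Finset.mem_biUnion] at hr
    rcases hr with (rfl | rfl) | hr | ⟨t, ht, hr⟩
    · exact ⟨_, pair_neg_mem hMS⟩
    · exact ⟨_, hMS⟩
    · exact h1 _ _ hpq.derivative hder0 hderd r (Polynomial.isRoot_of_mem_roots hr)
    · exact h1 _ _ (hG t ht).1 (hG t ht).2.1 (hG t ht).2.2 r (Polynomial.isRoot_of_mem_roots hr)
  obtain ⟨⟨c₁, c₁'⟩, ⟨c₂, c₂'⟩, hc₁, hc₂, hcy, hyc, hfree⟩ :=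
    exists_pair_near R hRS hyS (b := -M) (b' := M) (by simp [hR]) (by simp [hR]) hMy hyM
  dsimp only at hcy hyc hfree
  have hneg := hK.mul_eval_neg hcy hyc hy (hroot _ _ hc₁) (hroot _ _ hc₂) (fun c h3 h4 h5 =>
    hfree c (by simp [hR, hder0, h5]) h3 h4)
  have hlt' : c₁' < c₂' := (hS.1.lt_iff hc₁ hc₂).1 (hcy.trans hyc)
  obtain ⟨z, hz1, hz2, hz⟩ := hL q c₁' c₂' hlt'
    ((hS.1.neg_iff (pair_mul_mem (hpq.eval_mem hc₁) (hpq.eval_mem hc₂))).1 hneg)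
  refine ⟨z, hz, fun r hr => ?_⟩
  obtain ⟨hrS, hr0, hrd⟩ := hG r hr
  have htwo : ((2 : K), (2 : L)) ∈ S := by
    have := pair_add_mem (pair_one_mem (S := S)) (pair_one_mem (S := S))
    norm_num at this
    exact this
  have hmid : ((c₁ + c₂) * 2⁻¹, (c₁' + c₂') * 2⁻¹) ∈ S :=
    pair_mul_mem (pair_add_mem hc₁ hc₂) (inv_mem_of_maximal hS htwo)
  have hm1 : c₁ < (c₁ + c₂) * 2⁻¹ ∧ (c₁ + c₂) * 2⁻¹ < c₂ := by constructor <;> linarith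
  have hm2 : c₁' < (c₁' + c₂') * 2⁻¹ ∧ (c₁' + c₂') * 2⁻¹ < c₂' := by constructor <;> linarith
  have hfreeK : ∀ c, c₁ < c → c < c₂ → r.1.eval c ≠ 0 := fun c h3 h4 h5 =>
    hfree c (by
      simp only [hR, Finset.mem_union, Finset.mem_biUnion, Multiset.mem_toFinset]
      exact Or.inr (Or.inr ⟨r, hr, by simp [hr0, h5]⟩)) h3 h4
  have hfreeL : ∀ c, c₁' < c → c < c₂' → r.2.eval c ≠ 0 := by
    intro c h3 h4 h5
    obtain ⟨w, hw⟩ := h2 _ _ hrS.swap (fun h => hr0 ((hrS.eq_zero_iff hS.1).2 h))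
      (by rwa [← hrS.natDegree_eq hS.1]) c h5
    have hw' : (w, c) ∈ S := hw
    exact hfreeK w ((hS.1.lt_iff hc₁ hw').2 h3) ((hS.1.lt_iff hw' hc₂).2 h4)
      ((hS.1.eq_zero_iff (hrS.eval_mem hw')).2 h5)
  have hmm := hS.1 _ _ (hrS.eval_mem hmid)
  exact ⟨fun h => hL.eval_pos_of_eval_pos hfreeL hm2.1 hm2.2 hz1 hz2
      (hmm.1 (hK.eval_pos_of_eval_pos hfreeK hcy hyc hm1.1 hm1.2 h)),
    fun h => hK.eval_pos_of_eval_pos hfreeK hm1.1 hm1.2 hcy hyc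
      (hmm.2 (hL.eval_pos_of_eval_pos hfreeL hz1 hz2 hm2.1 hm2.2 h))⟩

lemma mem_of_root_of_monic (hK : PolyIVT K) (hL : PolyIVT L) (hS : Maximal SignCompat S)
    {p : Polynomial K} {q : Polynomial L} (hpq : PolyPair S p q) (hp : p.Monic)
    (h1 : FstRoots S p.natDegree) (h2 : FstRoots (swapSubring S) p.natDegree)
    {y : K} (hy : p.eval y = 0) : ∃ z, (y, z) ∈ S := by
  classical
  by_contra! hyS
  have hq := hpq.monic hS.1 hp
  have hlow : ∀ r t, PolyPair S r t → r ≠ 0 → r.natDegree < p.natDegree → r.eval y ≠ 0 := by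
    intro r t hrt hr hdeg h0
    obtain ⟨z, hz⟩ := h1 r t hrt hr hdeg y h0
    exact hyS z hz
  have hd : p ≠ 1 := by
    rintro rfl
    simp at hy
  obtain ⟨z, hz, hmatch⟩ : ∃ z, q.eval z = 0 ∧ ∀ r t, PolyPair S r t → r ≠ 0 →
      r.natDegree < p.natDegree → (0 < r.eval y ↔ 0 < t.eval z) := by
    by_contra hcon
    have hcon' : ∀ z : L, ∃ P : Polynomial K × Polynomial L, q.eval z = 0 → PolyPair S P.1 P.2 ∧
        P.1 ≠ 0 ∧ P.1.natDegree < p.natDegree ∧ ¬ (0 < P.1.eval y ↔ 0 < P.2.eval z) := by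
      intro z
      by_cases hz : q.eval z = 0
      · by_contra hno
        exact hcon ⟨z, hz, fun r t h3 h4 h5 => by_contra fun hn =>
          hno ⟨(r, t), fun _ => ⟨h3, h4, h5, hn⟩⟩⟩
      · exact ⟨0, fun h => absurd h hz⟩
    choose P hP using hcon'
    obtain ⟨z, hz, h⟩ := exists_matching_root hK hL hS hpq hp h1 h2 hy hyS
      (q.roots.toFinset.image P) (by
        intro r hr
        obtain ⟨z, hz, rfl⟩ := Finset.mem_image.1 hr
        obtain ⟨h3, h4, h5, -⟩ := hP z (Polynomial.isRoot_of_mem_roots (by simpa using hz))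
        exact ⟨h3, h4, h5⟩)
    exact (hP z hz).2.2.2 (h _ (Finset.mem_image_of_mem P (by simp [hq.ne_zero, hz])))
  have hred : ∀ r t, PolyPair S r t → PolyPair S (r %ₘ p) (t %ₘ q) ∧
      r.eval y = (r %ₘ p).eval y ∧ t.eval z = (t %ₘ q).eval z ∧
      (r %ₘ p).natDegree < p.natDegree := by
    intro r t hrt
    refine ⟨(hrt.divModByMonic hS.1 hpq hp).2, ?_, ?_, Polynomial.natDegree_modByMonic_lt _ hp hd⟩
    · conv_lhs => rw [← Polynomial.modByMonic_add_div r p]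
      simp [hy]
    · conv_lhs => rw [← Polynomial.modByMonic_add_div t q]
      simp [hz]
  refine hyS z (mem_of_maximal_signCompat hS (fun r t hrt hpos => ?_) (fun r t hrt h0 => ?_))
  · obtain ⟨h3, h4, h5, h6⟩ := hred r t hrt
    rw [h4] at hpos
    rw [h5]
    refine (hmatch _ _ h3 ?_ h6).1 hpos
    intro h
    simp [h] at hpos
  · obtain ⟨h3, h4, h5, h6⟩ := hred r t hrt
    have : r %ₘ p = 0 := by
      by_contra hne
      exact hlow _ _ h3 hne h6 (h4 ▸ h0)
    rw [h5, (h3.eq_zero_iff hS.1).1 this, Polynomial.eval_zero]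

lemma fstRoots_succ (hK : PolyIVT K) (hL : PolyIVT L) (hS : Maximal SignCompat S) {d : ℕ}
    (h1 : FstRoots S d) (h2 : FstRoots (swapSubring S) d) : FstRoots S (d + 1) := by
  intro p q hpq hp0 hdeg y hy
  have hl : p.leadingCoeff ≠ 0 := Polynomial.leadingCoeff_ne_zero.2 hp0
  have hmem : (p.leadingCoeff⁻¹, (q.coeff p.natDegree)⁻¹) ∈ S :=
    inv_mem_of_maximal hS (hpq p.natDegree)
  have hpair := (PolyPair.C hmem).mul hpq
  have hnd : (Polynomial.C p.leadingCoeff⁻¹ * p).natDegree ≤ d := by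
    rw [Polynomial.natDegree_C_mul (inv_ne_zero hl)]; omega
  exact mem_of_root_of_monic hK hL hS hpair
    (by rw [mul_comm]; exact Polynomial.monic_mul_leadingCoeff_inv hp0)
    (fun p q h h0 hd => h1 p q h h0 (hd.trans_le hnd))
    (fun p q h h0 hd => h2 p q h h0 (hd.trans_le hnd)) (by simp [hy])

lemma fstRoots_of_maximal (hK : PolyIVT K) (hL : PolyIVT L) (hS : Maximal SignCompat S) (d : ℕ) :
    FstRoots S d := by
  suffices H : FstRoots S d ∧ FstRoots (swapSubring S) d from H.1
  induction d with
  | zero => exact ⟨fun _ _ _ _ h => absurd h (by omega), fun _ _ _ _ h => absurd h (by omega)⟩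
  | succ d ih =>
    exact ⟨fstRoots_succ hK hL hS ih.1 ih.2, fstRoots_succ hL hK (maximal_swap hS) ih.2 ih.1⟩

end AlgebraicStep

section Germ

open Filter

variable {E : Type} [Field E] [LinearOrder E] [IsStrictOrderedRing E] {α : Type}
  (U : Ultrafilter α)

/-- The germ at `U` of a function, as a ring homomorphism. -/
def germHom : (α → E) →+* Filter.Germ (U : Filter α) E := Filter.Germ.coeRingHom (U : Filter α)

lemma germHom_surjective : Function.Surjective (germHom (E := E) U) := fun x =>
  Filter.Germ.inductionOn x fun f => ⟨f, rfl⟩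

lemma germHom_pos_iff (f : α → E) : 0 < germHom U f ↔ ∀ᶠ e in (U : Filter α), 0 < f e :=
  Filter.Germ.coe_pos

lemma germHom_lt_iff (f g : α → E) : germHom U f < germHom U g ↔
    ∀ᶠ e in (U : Filter α), f e < g e :=
  Filter.Germ.coe_lt

lemma germHom_eq_iff (f g : α → E) : germHom U f = germHom U g ↔
    ∀ᶠ e in (U : Filter α), f e = g e :=
  Filter.Germ.coe_eq

lemma PolyIVT.germ (hE : PolyIVT E) : PolyIVT (Filter.Germ (U : Filter α) E) := by
  intro p a b hab h
  obtain ⟨P, rfl⟩ := Polynomial.map_surjective _ (germHom_surjective (E := E) U) p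
  obtain ⟨a, rfl⟩ := germHom_surjective U a
  obtain ⟨b, rfl⟩ := germHom_surjective U b
  have hev : ∀ c : α → E, ∀ e, P.eval c e = (P.map (Pi.evalRingHom _ e)).eval (c e) := fun c e =>
    (Polynomial.eval_map_apply (Pi.evalRingHom (fun _ : α => E) e) (p := P) c).symm
  rw [Polynomial.eval_map_apply, Polynomial.eval_map_apply, ← map_mul,
    ← map_zero (germHom (E := E) U), germHom_lt_iff] at h
  rw [germHom_lt_iff] at hab
  have key : ∀ e, ∃ c, (a e < b e → (P.eval a * P.eval b) e < 0 →
      a e < c ∧ c < b e ∧ (P.map (Pi.evalRingHom _ e)).eval c = 0) := by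
    intro e
    by_cases h1 : a e < b e ∧ (P.eval a * P.eval b) e < 0
    · obtain ⟨c, hc⟩ := hE (P.map (Pi.evalRingHom _ e)) (a e) (b e) h1.1 (by
        rw [← hev, ← hev]; exact h1.2)
      exact ⟨c, fun _ _ => hc⟩
    · exact ⟨0, fun h2 h3 => absurd ⟨h2, h3⟩ h1⟩
  choose c hc using key
  refine ⟨germHom U c, ?_, ?_, ?_⟩
  · rw [germHom_lt_iff]
    filter_upwards [hab, h] with e h1 h2 using (hc e h1 h2).1
  · rw [germHom_lt_iff]
    filter_upwards [hab, h] with e h1 h2 using (hc e h1 h2).2.1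
  · rw [Polynomial.eval_map_apply, ← map_zero (germHom (E := E) U), germHom_eq_iff]
    filter_upwards [hab, h] with e h1 h2
    rw [hev]
    exact (hc e h1 h2).2.2

/-- Finite sign conditions on real polynomials that are realized in `E` are realized in `ℝ`. -/
def SpecializesToReal (σ : Type) {E : Type} [Field E] [LinearOrder E] (φ : ℝ →+* E) : Prop :=
  ∀ (z : σ → E) (Q : Finset (MvPolynomial σ ℝ)), ∃ a : σ → ℝ, ∀ q ∈ Q,
    (0 < eval₂ φ z q ↔ 0 < eval a q)

lemma SpecializesToReal.germ {σ : Type} {φ : ℝ →+* E} (h : SpecializesToReal σ φ) :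
    SpecializesToReal σ ((germHom (E := E) U).comp ((Pi.constRingHom α E).comp φ)) := by
  intro z Q
  choose w hw using fun i => germHom_surjective U (z i)
  have hev : ∀ q, eval₂ ((germHom (E := E) U).comp ((Pi.constRingHom α E).comp φ)) z q =
      germHom U (fun e => eval₂ φ (fun i => w i e) q) := by
    intro q
    have h1 : z = germHom U ∘ w := funext fun i => (hw i).symm
    rw [h1]
    rw [← MvPolynomial.eval₂_comp_left]
    congr 1
    ext e
    exact MvPolynomial.eval₂_comp_left (Pi.evalRingHom (fun _ : α => E) e) _ _ _
  have hev' : ∀ q ∈ Q, ∀ᶠ e in (U : Filter α),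
      (0 < eval₂ ((germHom (E := E) U).comp ((Pi.constRingHom α E).comp φ)) z q ↔
        0 < eval₂ φ (fun i => w i e) q) := by
    intro q _
    rw [hev, germHom_pos_iff]
    by_cases hq : ∀ᶠ e in (U : Filter α), 0 < eval₂ φ (fun i => w i e) q
    · filter_upwards [hq] with e he
      simp [hq, he]
    · filter_upwards [Ultrafilter.eventually_not.2 hq] with e he
      simp [hq, he]
  obtain ⟨e, he⟩ := ((Filter.eventually_all_finset Q).2 hev').exists
  obtain ⟨a, ha⟩ := h (fun i => w i e) Q
  exact ⟨a, fun q hq => (he q hq).trans (ha q hq)⟩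

end Germ

section Transcendental

variable {K : Type} [Field K] [LinearOrder K] [IsStrictOrderedRing K]
  {E : Type} [Field E] [LinearOrder E] [IsStrictOrderedRing E] {S : Subring (K × E)}

lemma exists_pair_same_side (hS : Maximal SignCompat S) (R : Finset K)
    (hR : ∀ r ∈ R, ∃ r', (r, r') ∈ S) {x : K} (hx : ∀ z, (x, z) ∉ S) :
    ∃ c : K × E, c ∈ S ∧ ∀ r ∈ R, (r < x ∧ r < c.1) ∨ (x < r ∧ c.1 < r) := by
  have hlr : ∀ r ∈ R, r < x ∨ x < r := by
    intro r hr
    rcases lt_trichotomy r x with h | h | h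
    · exact Or.inl h
    · obtain ⟨r', hr'⟩ := hR r hr
      exact absurd (h ▸ hr') (hx r')
    · exact Or.inr h
  by_cases h1 : (R.filter (· < x)).Nonempty <;> by_cases h2 : (R.filter (x < ·)).Nonempty
  · have m1 := Finset.mem_filter.1 (Finset.max'_mem _ h1)
    have m2 := Finset.mem_filter.1 (Finset.min'_mem _ h2)
    obtain ⟨c1, hc1⟩ := hR _ m1.1
    obtain ⟨c2, hc2⟩ := hR _ m2.1
    have htwo : ((2 : K), (2 : E)) ∈ S := by
      have := pair_add_mem (pair_one_mem (S := S)) (pair_one_mem (S := S))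
      norm_num at this
      exact this
    refine ⟨_, pair_mul_mem (pair_add_mem hc1 hc2) (inv_mem_of_maximal hS htwo), fun r hr => ?_⟩
    have h12 := m1.2.trans m2.2
    rcases hlr r hr with h | h
    · have := Finset.le_max' (R.filter (· < x)) r (Finset.mem_filter.2 ⟨hr, h⟩)
      exact Or.inl ⟨h, by dsimp only; linarith⟩
    · have := Finset.min'_le (R.filter (x < ·)) r (Finset.mem_filter.2 ⟨hr, h⟩)
      exact Or.inr ⟨h, by dsimp only; linarith⟩
  · have m1 := Finset.mem_filter.1 (Finset.max'_mem _ h1)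
    obtain ⟨c1, hc1⟩ := hR _ m1.1
    refine ⟨_, pair_add_mem hc1 pair_one_mem, fun r hr => ?_⟩
    rcases hlr r hr with h | h
    · have := Finset.le_max' (R.filter (· < x)) r (Finset.mem_filter.2 ⟨hr, h⟩)
      exact Or.inl ⟨h, by dsimp only; linarith⟩
    · exact absurd ⟨r, Finset.mem_filter.2 ⟨hr, h⟩⟩ h2
  · have m2 := Finset.mem_filter.1 (Finset.min'_mem _ h2)
    obtain ⟨c2, hc2⟩ := hR _ m2.1
    refine ⟨_, pair_sub_mem hc2 pair_one_mem, fun r hr => ?_⟩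
    rcases hlr r hr with h | h
    · exact absurd ⟨r, Finset.mem_filter.2 ⟨hr, h⟩⟩ h1
    · have := Finset.min'_le (R.filter (x < ·)) r (Finset.mem_filter.2 ⟨hr, h⟩)
      exact Or.inr ⟨h, by dsimp only; linarith⟩
  · refine ⟨_, pair_zero_mem, fun r hr => ?_⟩
    rcases hlr r hr with h | h
    · exact absurd ⟨r, Finset.mem_filter.2 ⟨hr, h⟩⟩ h1
    · exact absurd ⟨r, Finset.mem_filter.2 ⟨hr, h⟩⟩ h2

/-- The sets of candidates for a partner of `x` cut out by finitely many sign conditions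
are nonempty. -/
lemma exists_forall_eval_pos (hK : PolyIVT K) (hE : PolyIVT E) (hS : Maximal SignCompat S)
    {x : K} (hx : ∀ z, (x, z) ∉ S) (G : Finset (Polynomial K × Polynomial E))
    (hG : ∀ r ∈ G, PolyPair S r.1 r.2 ∧ 0 < r.1.eval x) : ∃ e : E, ∀ r ∈ G, 0 < r.2.eval e := by
  classical
  have hG0 : ∀ r ∈ G, r.1 ≠ 0 := fun r hr h => by simpa [h] using (hG r hr).2
  obtain ⟨⟨c, c'⟩, hc, h⟩ := exists_pair_same_side hS (G.biUnion fun r => r.1.roots.toFinset) (by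
    intro r hr
    obtain ⟨t, ht, hr⟩ := Finset.mem_biUnion.1 hr
    exact fstRoots_of_maximal hK hE hS _ _ _ (hG t ht).1 (hG0 t ht) (Nat.lt_succ_self _) r
      (Polynomial.isRoot_of_mem_roots (by simpa using hr))) hx
  refine ⟨c', fun r hr => (hS.1 _ _ ((hG r hr).1.eval_mem hc)).1 ?_⟩
  have hroot : ∀ w, r.1.eval w = 0 → (w < x ∧ w < c) ∨ (x < w ∧ c < w) := fun w hw =>
    h w (Finset.mem_biUnion.2 ⟨r, hr, by simp [hG0 r hr, hw]⟩)
  have hx0 := (hG r hr).2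
  have hc0 : r.1.eval c ≠ 0 := fun h0 => by
    rcases hroot c h0 with h | h <;> exact absurd h.2 (lt_irrefl _)
  rcases le_total c x with hcx | hcx
  · refine (mul_pos_iff_of_pos_right hx0).1 (hK.mul_eval_pos hcx hc0 hx0.ne' fun w h1 h2 h3 => ?_)
    rcases hroot w h3 with h | h
    · exact absurd h.2 (not_lt.2 h1.le)
    · exact absurd h.1 (not_lt.2 h2.le)
  · refine (mul_pos_iff_of_pos_left hx0).1 (hK.mul_eval_pos hcx hx0.ne' hc0 fun w h1 h2 h3 => ?_)
    rcases hroot w h3 with h | h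
    · exact absurd h.1 (not_lt.2 h1.le)
    · exact absurd h.2 (not_lt.2 h2.le)

/-- Any element of `K` acquires a partner in an ultrapower of `E`. -/
lemma exists_extension_step (hK : PolyIVT K) (hE : PolyIVT E) (hS : Maximal SignCompat S)
    {x : K} (hx : ∀ z, (x, z) ∉ S) : ∃ (U : Ultrafilter E)
    (T : Subring (K × Filter.Germ (U : Filter E) E)), SignCompat T ∧
      (∀ a b, (a, b) ∈ S → (a, germHom U (fun _ => b)) ∈ T) ∧ ∃ y, (x, y) ∈ T := by
  classical
  obtain ⟨U, hU⟩ := Ultrafilter.exists_ultrafilter_of_finite_inter_nonempty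
    {V : Set E | ∃ r t, PolyPair S r t ∧ 0 < r.eval x ∧ V = {e | 0 < t.eval e}} (by
      intro F hF
      have hF' : ∀ V : Set E, ∃ P : Polynomial K × Polynomial E, V ∈ F →
          PolyPair S P.1 P.2 ∧ 0 < P.1.eval x ∧ V = {e | 0 < P.2.eval e} := by
        intro V
        by_cases hV : V ∈ F
        · obtain ⟨r, t, h⟩ := hF hV
          exact ⟨(r, t), fun _ => h⟩
        · exact ⟨0, fun h => absurd h hV⟩
      choose P hP using hF'
      obtain ⟨e, he⟩ := exists_forall_eval_pos hK hE hS hx (F.image P) (by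
        intro r hr
        obtain ⟨V, hV, rfl⟩ := Finset.mem_image.1 hr
        exact ⟨(hP V hV).1, (hP V hV).2.1⟩)
      refine ⟨e, fun V hV => ?_⟩
      rw [(hP V hV).2.2]
      exact he _ (Finset.mem_image_of_mem P hV))
  have hpos : ∀ r t, PolyPair S r t → 0 < r.eval x → 0 < germHom U (fun e => t.eval e) :=
    fun r t h h0 => (germHom_pos_iff U _).2 (hU ⟨r, t, h, h0, rfl⟩)
  have hev : ∀ t : Polynomial E, germHom U (fun e => t.eval e) =
      t.eval₂ ((germHom U).comp (Pi.constRingHom E E)) (germHom U id) := by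
    intro t
    rw [← Polynomial.hom_eval₂]
    congr 1
    ext e
    exact (Polynomial.hom_eval₂ t (Pi.constRingHom E E) (Pi.evalRingHom (fun _ : E => E) e) id).symm
  refine ⟨U, ((Polynomial.eval₂RingHom ((RingHom.fst K E).comp S.subtype) x).prod
    (Polynomial.eval₂RingHom (((germHom U).comp (Pi.constRingHom E E)).comp
      ((RingHom.snd K E).comp S.subtype)) (germHom U id))).range, ?_, ?_, ?_⟩
  · rintro a b ⟨P, hP⟩
    have hpair := PolyPair.of_map P
    have ha : a = (P.map ((RingHom.fst K E).comp S.subtype)).eval x := by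
      rw [Polynomial.eval_map]; exact congrArg Prod.fst hP.symm
    have hb : b = germHom U
        (fun e => (P.map ((RingHom.snd K E).comp S.subtype)).eval e) := by
      rw [hev, Polynomial.eval₂_map]; exact congrArg Prod.snd hP.symm
    rw [ha, hb]
    refine ⟨hpos _ _ hpair, fun h => ?_⟩
    by_contra hn
    rcases (not_lt.1 hn).lt_or_eq with hlt | heq
    · have h1 := hpos _ _ hpair.neg (by simpa using hlt)
      have h2 : germHom U (fun e => (-P.map ((RingHom.snd K E).comp S.subtype)).eval e) =
          - germHom U (fun e => (P.map ((RingHom.snd K E).comp S.subtype)).eval e) := by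
        rw [← map_neg]
        congr 1
        ext e
        simp
      rw [h2, neg_pos] at h1
      exact lt_asymm h h1
    · by_cases h0 : P.map ((RingHom.fst K E).comp S.subtype) = 0
      · have h1 := (hpair.eq_zero_iff hS.1).1 h0
        rw [h1] at h
        simp only [Polynomial.eval_zero] at h
        rw [germHom_pos_iff] at h
        obtain ⟨e, he⟩ := h.exists
        exact lt_irrefl _ he
      · obtain ⟨z, hz⟩ := fstRoots_of_maximal hK hE hS _ _ _ hpair h0 (Nat.lt_succ_self _) x heq
        exact hx z hz
  · intro a b hab
    exact ⟨Polynomial.C ⟨(a, b), hab⟩, by simp; rfl⟩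
  · exact ⟨germHom U id, Polynomial.X, by simp⟩

lemma exists_specializing_extension (σ : Type) (hK : PolyIVT K) (ψ : ℝ →+* K) (s : Finset K) :
    ∃ (E : Type) (_ : Field E) (_ : LinearOrder E) (_ : IsStrictOrderedRing E) (φ : ℝ →+* E)
      (S : Subring (K × E)), PolyIVT E ∧ SpecializesToReal σ φ ∧ SignCompat S ∧
      (∀ r, (ψ r, φ r) ∈ S) ∧ ∀ x ∈ s, ∃ y, (x, y) ∈ S := by
  classical
  induction s using Finset.induction_on with
  | empty =>
    refine ⟨ℝ, inferInstance, inferInstance, inferInstance, RingHom.id ℝ,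
      (ψ.prod (RingHom.id ℝ)).range, ?_, ?_, ?_, fun r => ⟨r, rfl⟩, by simp⟩
    · intro p a b hab h
      have hc : ContinuousOn (fun x => p.eval x) (Set.Icc a b) := p.continuous.continuousOn
      rcases mul_neg_iff.1 h with h | h
      · obtain ⟨c, hc, h0⟩ := intermediate_value_Ioo' hab.le hc ⟨h.2, h.1⟩
        exact ⟨c, hc.1, hc.2, h0⟩
      · obtain ⟨c, hc, h0⟩ := intermediate_value_Ioo hab.le hc ⟨h.1, h.2⟩
        exact ⟨c, hc.1, hc.2, h0⟩
    · exact fun z Q => ⟨z, fun q _ => by rw [MvPolynomial.eval₂_id]⟩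
    · have key : ∀ r : ℝ, 0 < r → 0 < ψ r := by
        intro r hr
        rw [← Real.mul_self_sqrt hr.le, map_mul]
        exact mul_self_pos.2 ((map_ne_zero ψ).2 (Real.sqrt_ne_zero'.2 hr))
      rintro a b ⟨r, hr⟩
      obtain ⟨rfl, rfl⟩ := Prod.mk.injEq _ _ _ _ ▸ hr
      refine ⟨fun h => ?_, key r⟩
      by_contra hn
      rcases (not_lt.1 hn).lt_or_eq with hlt | heq
      · have hlt' : r < 0 := hlt
        have := key (-r) (by linarith)
        rw [map_neg, neg_pos] at this
        exact lt_asymm h this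
      · have heq' : r = 0 := heq
        simp [heq'] at h
  | insert x s hxs ih =>
    obtain ⟨E, _, _, _, φ, S, hE, hspec, hS, hφ, hs⟩ := ih
    obtain ⟨T, hST, hT⟩ := exists_maximal_signCompat hS
    by_cases hx : ∃ y, (x, y) ∈ T
    · refine ⟨E, inferInstance, inferInstance, inferInstance, φ, T, hE, hspec, hT.1,
        fun r => hST (hφ r), fun w hw => ?_⟩
      rcases Finset.mem_insert.1 hw with rfl | hw
      · exact hx
      · obtain ⟨y, hy⟩ := hs w hw
        exact ⟨y, hST hy⟩
    · obtain ⟨U, T', hT', hTT', hx'⟩ := exists_extension_step hK hE hT (not_exists.1 hx)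
      refine ⟨Filter.Germ (U : Filter E) E, inferInstance, inferInstance, inferInstance,
        (germHom U).comp ((Pi.constRingHom E E).comp φ), T',
        hE.germ U, hspec.germ U, hT', fun r => hTT' _ _ (hST (hφ r)), fun w hw => ?_⟩
      rcases Finset.mem_insert.1 hw with rfl | hw
      · exact hx'
      · obtain ⟨y, hy⟩ := hs w hw
        exact ⟨_, hTT' _ _ (hST hy)⟩

/-- The Artin-Lang property: a finite system of strict sign conditions realized in an ordered
field with the intermediate value property is realized over `ℝ`. -/
theorem artin_lang {σ : Type} [Finite σ] (hK : PolyIVT K) (ψ : ℝ →+* K) :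
    SpecializesToReal σ ψ := by
  classical
  have := Fintype.ofFinite σ
  intro z Q
  obtain ⟨E, _, _, _, φ, S, hE, hspec, hS, hφ, hs⟩ :=
    exists_specializing_extension σ hK ψ (Finset.univ.image z)
  choose w hw using fun i => hs (z i) (Finset.mem_image_of_mem z (Finset.mem_univ i))
  obtain ⟨a, ha⟩ := hspec w Q
  have key : ∀ q, (eval₂ ψ z q, eval₂ φ w q) ∈ S := by
    intro q
    induction q using MvPolynomial.induction_on with
    | C r => simpa using hφ r
    | add p q hp hq => simpa using pair_add_mem hp hq
    | mul_X p i hp => simpa using pair_mul_mem hp (hw i)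
  exact ⟨a, fun q hq => (hS _ _ (key q)).trans (ha q hq)⟩

end Transcendental

section SignChange

variable {F : Type*} [Field F] [LinearOrder F] [IsStrictOrderedRing F]

/-- A polynomial with a sign change has an irreducible factor with a sign change. -/
lemma exists_irreducible_factor_mul_eval_neg {p : Polynomial F} {a b : F}
    (h : p.eval a * p.eval b < 0) : ∃ q, Irreducible q ∧ q ∣ p ∧ q.eval a * q.eval b < 0 := by
  induction p using WfDvdMonoid.induction_on_irreducible with
  | zero => simp at h
  | unit u hu =>
    obtain ⟨c, -, rfl⟩ := Polynomial.isUnit_iff.1 hu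
    simp only [Polynomial.eval_C] at h
    exact absurd h (not_lt.2 (mul_self_nonneg c))
  | mul p i hp hi ih =>
    by_cases hneg : i.eval a * i.eval b < 0
    · exact ⟨i, hi, dvd_mul_right _ _, hneg⟩
    · obtain ⟨q, hq, hd, hs⟩ := ih (by
        by_contra hn
        rw [Polynomial.eval_mul, Polynomial.eval_mul, mul_mul_mul_comm] at h
        exact absurd h (not_lt.2 (mul_nonneg (not_lt.1 hneg) (not_lt.1 hn))))
      exact ⟨q, hq, hd.mul_left _, hs⟩

/-- The ordering of `F` extends to `F[X] / (f)` if `f` is irreducible with a sign change. -/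
lemma Irreducible.dvd_of_dvd_sum_sq {ι : Type} [Fintype ι] {f : Polynomial F}
    (hf : Irreducible f) {a b : F} (hab : f.eval a * f.eval b < 0) {p : ι → F}
    (hp : ∀ i, 0 < p i) {g : ι → Polynomial F} (h : f ∣ ∑ i, Polynomial.C (p i) * g i ^ 2) (i : ι) :
    f ∣ g i := by
  classical
  induction hd : f.natDegree using Nat.strong_induction_on generalizing f g i with
  | _ d ih =>
  let _ : NormalizedGCDMonoid (Polynomial F) :=
    (UniqueFactorizationMonoid.toNormalizedGCDMonoid (Polynomial F))
  by_contra hi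
  have hf0 : f ≠ 0 := hf.ne_zero
  set r : ι → Polynomial F := fun j => g j % f with hr
  have hrd : ∀ j, f ∣ r j ↔ f ∣ g j := fun j => EuclideanDomain.dvd_mod_iff dvd_rfl
  have hr2 : f ∣ ∑ j, Polynomial.C (p j) * r j ^ 2 := by
    have h1 : f ∣ ∑ j, Polynomial.C (p j) * g j ^ 2 - ∑ j, Polynomial.C (p j) * r j ^ 2 := by
      rw [← Finset.sum_sub_distrib]
      refine Finset.dvd_sum fun j _ => ⟨Polynomial.C (p j) * (g j / f) * (g j + r j), ?_⟩
      have := EuclideanDomain.mod_eq_sub_mul_div (g j) f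
      simp only [hr, this]
      ring
    exact (dvd_sub_right h).1 h1
  have hri : r i ≠ 0 := fun h0 => hi ((hrd i).1 (h0 ▸ dvd_zero f))
  obtain ⟨s, hs, hs1⟩ := Finset.extract_gcd r ⟨i, Finset.mem_univ i⟩
  set e := Finset.univ.gcd r with he
  have he0 : e ≠ 0 := fun h0 => hri (by rw [hs i (Finset.mem_univ i), h0, zero_mul])
  have hrdeg : ∀ j, (r j).degree < f.degree := fun j => Polynomial.degree_mod_lt _ hf0
  have hed : e.degree < f.degree :=
    (Polynomial.degree_le_of_dvd (Finset.gcd_dvd (Finset.mem_univ i)) hri).trans_lt (hrdeg i)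
  have hfe : ¬ f ∣ e := fun h => absurd (Polynomial.degree_le_of_dvd h he0) (not_le.2 hed)
  have hsdeg : ∀ j, (s j).natDegree < f.natDegree := by
    intro j
    by_cases hj : s j = 0
    · rw [hj, Polynomial.natDegree_zero]
      exact hf.natDegree_pos
    · refine Polynomial.natDegree_lt_natDegree hj (lt_of_le_of_lt ?_ (hrdeg j))
      rw [hs j (Finset.mem_univ j), mul_comm]
      exact Polynomial.degree_le_mul_left _ he0
  have hfs : f ∣ ∑ j, Polynomial.C (p j) * s j ^ 2 := by
    have h1 : ∑ j, Polynomial.C (p j) * r j ^ 2 = e ^ 2 * ∑ j, Polynomial.C (p j) * s j ^ 2 := by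
      rw [Finset.mul_sum]
      refine Finset.sum_congr rfl fun j hj => ?_
      rw [hs j hj]
      ring
    rw [h1] at hr2
    exact (hf.prime.dvd_or_dvd hr2).resolve_left fun h => hfe (hf.prime.dvd_of_dvd_pow h)
  obtain ⟨h', hh'⟩ := hfs
  have hpos : ∀ c, 0 < (∑ j, Polynomial.C (p j) * s j ^ 2).eval c := by
    intro c
    have h0 : ∀ j ∈ Finset.univ, 0 ≤ p j * (s j).eval c ^ 2 := fun j _ =>
      mul_nonneg (hp j).le (sq_nonneg _)
    simp only [Polynomial.eval_finsetSum, Polynomial.eval_mul, Polynomial.eval_C,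
      Polynomial.eval_pow]
    refine lt_of_le_of_ne (Finset.sum_nonneg h0) fun h1 => ?_
    have h2 := (Finset.sum_eq_zero_iff_of_nonneg h0).1 h1.symm
    have h3 : (Polynomial.X - Polynomial.C c) ∣ Finset.univ.gcd s :=
      Finset.dvd_gcd fun j hj => Polynomial.dvd_iff_isRoot.2 (by
        have := h2 j hj
        simpa [(hp j).ne'] using this)
    rw [hs1] at h3
    exact Polynomial.not_isUnit_X_sub_C c (isUnit_of_dvd_one h3)
  have ha := hpos a
  have hb := hpos b
  rw [hh', Polynomial.eval_mul] at ha hb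
  have hneg : h'.eval a * h'.eval b < 0 := by
    have := mul_pos ha hb
    rw [mul_mul_mul_comm] at this
    by_contra hn
    exact absurd (mul_nonpos_of_nonpos_of_nonneg hab.le (not_lt.1 hn)) (not_le.2 this)
  have hh0 : h' ≠ 0 := by rintro rfl; simp at hneg
  obtain ⟨q, hq, hqd, hqs⟩ := exists_irreducible_factor_mul_eval_neg hneg
  have hdeg : (∑ j, Polynomial.C (p j) * s j ^ 2).natDegree ≤ 2 * (f.natDegree - 1) := by
    refine Polynomial.natDegree_sum_le_of_forall_le _ _ fun j _ => ?_
    refine (Polynomial.natDegree_C_mul_le _ _).trans (Polynomial.natDegree_pow_le.trans ?_)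
    have := hsdeg j
    gcongr
    omega
  rw [hh', Polynomial.natDegree_mul hf0 hh0] at hdeg
  have hfpos := hf.natDegree_pos
  have hqle := Polynomial.natDegree_le_of_dvd hqd hh0
  have hqs' : ∀ j, q ∣ s j := fun j =>
    ih q.natDegree (by omega) hq hqs (hh' ▸ hqd.mul_left f) j rfl
  have := Finset.dvd_gcd fun j (_ : j ∈ Finset.univ) => hqs' j
  rw [hs1] at this
  exact hq.not_isUnit (isUnit_of_dvd_one this)

end SignChange

section OrdPair

variable {C : Type} [Field C]

/-- A subring together with a salient cone containing all of its squares. -/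
structure OrdPair (q : Subring C × Subsemiring C) : Prop where
  mem_ring : ∀ t ∈ q.2, t ∈ q.1
  sq_mem : ∀ b ∈ q.1, b * b ∈ q.2
  salient : ∀ t ∈ q.2, -t ∈ q.2 → t = 0

lemma OrdPair.exists_maximal {q : Subring C × Subsemiring C} (hq : OrdPair q) :
    ∃ r, q ≤ r ∧ Maximal OrdPair r := by
  refine zorn_le_nonempty₀ {r | OrdPair r} (fun c hc hchain r hr => ?_) q hq
  have hd1 : DirectedOn (· ≤ ·) (Prod.fst '' c) := by
    rintro _ ⟨x, hx, rfl⟩ _ ⟨y, hy, rfl⟩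
    obtain ⟨z, hz, h1, h2⟩ := hchain.directedOn x hx y hy
    exact ⟨_, ⟨z, hz, rfl⟩, h1.1, h2.1⟩
  have hd2 : DirectedOn (· ≤ ·) (Prod.snd '' c) := by
    rintro _ ⟨x, hx, rfl⟩ _ ⟨y, hy, rfl⟩
    obtain ⟨z, hz, h1, h2⟩ := hchain.directedOn x hx y hy
    exact ⟨_, ⟨z, hz, rfl⟩, h1.2, h2.2⟩
  have hm1 : ∀ x, x ∈ sSup (Prod.fst '' c) ↔ ∃ z ∈ c, x ∈ z.1 := fun x => by
    rw [Subring.mem_sSup_of_directedOn (Set.Nonempty.image _ ⟨r, hr⟩) hd1]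
    exact Set.exists_mem_image
  have hm2 : ∀ x, x ∈ sSup (Prod.snd '' c) ↔ ∃ z ∈ c, x ∈ z.2 := fun x => by
    rw [Subsemiring.mem_sSup_of_directedOn (Set.Nonempty.image _ ⟨r, hr⟩) hd2]
    exact Set.exists_mem_image
  refine ⟨(sSup (Prod.fst '' c), sSup (Prod.snd '' c)), ⟨fun t ht => ?_, fun b hb => ?_,
    fun t ht ht' => ?_⟩, fun z hz => ⟨le_sSup ⟨z, hz, rfl⟩, le_sSup ⟨z, hz, rfl⟩⟩⟩
  · obtain ⟨z, hz, h⟩ := (hm2 t).1 ht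
    exact (hm1 t).2 ⟨z, hz, (hc hz).mem_ring t h⟩
  · obtain ⟨z, hz, h⟩ := (hm1 b).1 hb
    exact (hm2 _).2 ⟨z, hz, (hc hz).sq_mem b h⟩
  · obtain ⟨z, hz, h⟩ := (hm2 t).1 ht
    obtain ⟨w, hw, h'⟩ := (hm2 _).1 ht'
    obtain ⟨v, hv, h1, h2⟩ := hchain.directedOn z hz w hw
    exact (hc hv).salient t (h1.2 h) (h2.2 h')

variable {q : Subring C × Subsemiring C}

lemma OrdPair.mem_of_mul_mem (hq : Maximal OrdPair q) :
    (∀ s ∈ q.1, ∀ c, s ≠ 0 → s * c ∈ q.1 → c ∈ q.1) ∧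
    (∀ s ∈ q.1, ∀ c, s ≠ 0 → s * s * c ∈ q.2 → c ∈ q.2) := by
  let B : Subring C :=
    { carrier := {c | ∃ s ∈ q.1, s ≠ 0 ∧ s * c ∈ q.1}
      mul_mem' := by
        rintro a b ⟨s, hs, hs0, h⟩ ⟨t, ht, ht0, h'⟩
        exact ⟨s * t, mul_mem hs ht, mul_ne_zero hs0 ht0, by
          rw [mul_mul_mul_comm]; exact mul_mem h h'⟩
      one_mem' := ⟨1, one_mem _, one_ne_zero, by simp [one_mem]⟩
      add_mem' := by
        rintro a b ⟨s, hs, hs0, h⟩ ⟨t, ht, ht0, h'⟩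
        refine ⟨s * t, mul_mem hs ht, mul_ne_zero hs0 ht0, ?_⟩
        have : s * t * (a + b) = t * (s * a) + s * (t * b) := by ring
        rw [this]
        exact add_mem (mul_mem ht h) (mul_mem hs h')
      zero_mem' := ⟨1, one_mem _, one_ne_zero, by simp [zero_mem]⟩
      neg_mem' := by
        rintro a ⟨s, hs, hs0, h⟩
        exact ⟨s, hs, hs0, by rw [mul_neg]; exact neg_mem h⟩ }
  let T : Subsemiring C :=
    { carrier := {c | ∃ s ∈ q.1, s ≠ 0 ∧ s * s * c ∈ q.2}
      mul_mem' := by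
        rintro a b ⟨s, hs, hs0, h⟩ ⟨t, ht, ht0, h'⟩
        refine ⟨s * t, mul_mem hs ht, mul_ne_zero hs0 ht0, ?_⟩
        have : s * t * (s * t) * (a * b) = (s * s * a) * (t * t * b) := by ring
        rw [this]
        exact mul_mem h h'
      one_mem' := ⟨1, one_mem _, one_ne_zero, by simp [one_mem]⟩
      add_mem' := by
        rintro a b ⟨s, hs, hs0, h⟩ ⟨t, ht, ht0, h'⟩
        refine ⟨s * t, mul_mem hs ht, mul_ne_zero hs0 ht0, ?_⟩
        have : s * t * (s * t) * (a + b) = (t * t) * (s * s * a) + (s * s) * (t * t * b) := by ring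
        rw [this]
        exact add_mem (mul_mem (hq.1.sq_mem t ht) h) (mul_mem (hq.1.sq_mem s hs) h')
      zero_mem' := ⟨1, one_mem _, one_ne_zero, by simp [zero_mem]⟩ }
  have hp : OrdPair (B, T) := by
    refine ⟨?_, ?_, ?_⟩
    · rintro t ⟨s, hs, hs0, h⟩
      exact ⟨s * s, mul_mem hs hs, mul_ne_zero hs0 hs0, hq.1.mem_ring _ h⟩
    · rintro b ⟨s, hs, hs0, h⟩
      exact ⟨s, hs, hs0, by rw [← mul_mul_mul_comm]; exact hq.1.sq_mem _ h⟩
    · rintro t ⟨s, hs, hs0, h⟩ ⟨r, hr, hr0, h'⟩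
      have := hq.1.salient (s * s * (r * r) * t)
        (by
          have : s * s * (r * r) * t = (r * r) * (s * s * t) := by ring
          rw [this]
          exact mul_mem (hq.1.sq_mem r hr) h)
        (by
          have : -(s * s * (r * r) * t) = (s * s) * (r * r * -t) := by ring
          rw [this]
          exact mul_mem (hq.1.sq_mem s hs) h')
      simpa [hs0, hr0] using this
  have hle : q ≤ (B, T) := ⟨fun c hc => ⟨1, one_mem _, one_ne_zero, by simpa using hc⟩,
    fun c hc => ⟨1, one_mem _, one_ne_zero, by simpa using hc⟩⟩
  have hge := hq.2 hp hle
  exact ⟨fun s hs c h0 h => hge.1 ⟨s, hs, h0, h⟩, fun s hs c h0 h => hge.2 ⟨s, hs, h0, h⟩⟩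

lemma OrdPair.inv_mem (hq : Maximal OrdPair q) {b : C} (hb : b ∈ q.1) : b⁻¹ ∈ q.1 := by
  by_cases h0 : b = 0
  · simp [h0, zero_mem]
  · exact (OrdPair.mem_of_mul_mem hq).1 b hb _ h0 (by rw [mul_inv_cancel₀ h0]; exact one_mem _)

lemma OrdPair.mem_or_neg_mem (hq : Maximal OrdPair q) {b : C} (hb : b ∈ q.1) :
    b ∈ q.2 ∨ -b ∈ q.2 := by
  by_contra! hcon
  obtain ⟨hb1, hb2⟩ := hcon
  let T : Subsemiring C :=
    { carrier := {c | ∃ t₁ ∈ q.2, ∃ t₂ ∈ q.2, c = t₁ - b * t₂}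
      mul_mem' := by
        rintro _ _ ⟨t₁, h1, t₂, h2, rfl⟩ ⟨t₃, h3, t₄, h4, rfl⟩
        exact ⟨t₁ * t₃ + (b * b) * (t₂ * t₄), add_mem (mul_mem h1 h3)
          (mul_mem (hq.1.sq_mem b hb) (mul_mem h2 h4)), t₁ * t₄ + t₂ * t₃,
          add_mem (mul_mem h1 h4) (mul_mem h2 h3), by ring⟩
      one_mem' := ⟨1, one_mem _, 0, zero_mem _, by ring⟩
      add_mem' := by
        rintro _ _ ⟨t₁, h1, t₂, h2, rfl⟩ ⟨t₃, h3, t₄, h4, rfl⟩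
        exact ⟨t₁ + t₃, add_mem h1 h3, t₂ + t₄, add_mem h2 h4, by ring⟩
      zero_mem' := ⟨0, zero_mem _, 0, zero_mem _, by ring⟩ }
  have hp : OrdPair (q.1, T) := by
    refine ⟨?_, fun c hc => ⟨c * c, hq.1.sq_mem c hc, 0, zero_mem _, by ring⟩, ?_⟩
    · rintro _ ⟨t₁, h1, t₂, h2, rfl⟩
      exact sub_mem (hq.1.mem_ring _ h1) (mul_mem hb (hq.1.mem_ring _ h2))
    · rintro t ⟨t₁, h1, t₂, h2, rfl⟩ ⟨t₃, h3, t₄, h4, h⟩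
      have hsum : t₁ + t₃ = b * (t₂ + t₄) := by linear_combination -h
      have hu : t₂ + t₄ = 0 := by
        by_contra hu
        refine hb1 ((OrdPair.mem_of_mul_mem hq).2 (t₂ + t₄)
          (hq.1.mem_ring _ (add_mem h2 h4)) b hu ?_)
        have : (t₂ + t₄) * (t₂ + t₄) * b = (t₂ + t₄) * (t₁ + t₃) := by rw [hsum]; ring
        rw [this]
        exact mul_mem (add_mem h2 h4) (add_mem h1 h3)
      rw [hu, mul_zero] at hsum
      have e1 := hq.1.salient t₁ h1 (by rw [neg_eq_of_add_eq_zero_right hsum]; exact h3)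
      have e2 := hq.1.salient t₂ h2 (by rw [neg_eq_of_add_eq_zero_right hu]; exact h4)
      rw [e1, e2]; ring
  have hge := hq.2 hp ⟨le_rfl, fun c hc => ⟨c, hc, 0, zero_mem _, by ring⟩⟩
  exact hb2 (hge.2 ⟨0, zero_mem _, 1, one_mem _, by ring⟩)

/-- The subfield carrying a maximal ordering. -/
def ordSubfield (hq : Maximal OrdPair q) : Subfield C :=
  { q.1 with inv_mem' := fun _ h => OrdPair.inv_mem hq h }

/-- The cone of nonnegative elements of `ordSubfield`. -/
def ordCone (hq : Maximal OrdPair q) : RingCone (ordSubfield hq) :=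
  { q.2.comap (ordSubfield hq).subtype with
    eq_zero_of_mem_of_neg_mem' := fun {a} h h' => Subtype.ext (hq.1.salient a h h') }

/-- The linear order on `ordSubfield`. -/
abbrev ordLinearOrder (hq : Maximal OrdPair q) : LinearOrder (ordSubfield hq) :=
  { PartialOrder.mkOfAddGroupCone (ordCone hq) with
    le_total := fun a b => by
      rcases OrdPair.mem_or_neg_mem hq (b - a).2 with h | h
      · exact Or.inl h
      · refine Or.inr (show ((a - b : ordSubfield hq) : C) ∈ q.2 from ?_)
        rw [← neg_sub]
        exact h
    toDecidableLE := Classical.decRel _ }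

lemma ordLinearOrder_isStrictOrderedRing (hq : Maximal OrdPair q) :
    let _ := ordLinearOrder hq
    IsStrictOrderedRing (ordSubfield hq) := by
  intro _
  have : IsOrderedRing (ordSubfield hq) := IsOrderedRing.mkOfCone (ordCone hq)
  exact IsOrderedRing.toIsStrictOrderedRing _

lemma ord_nonneg_iff (hq : Maximal OrdPair q) (a : ordSubfield hq) :
    let _ := ordLinearOrder hq
    0 ≤ a ↔ (a : C) ∈ q.2 := by
  intro _
  change ((a - 0 : ordSubfield hq) : C) ∈ q.2 ↔ _
  rw [sub_zero]

/-- Any root of an irreducible polynomial with a sign change lies in a maximal ordered field. -/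
lemma ord_root_mem (hq : Maximal OrdPair q) {f : Polynomial (ordSubfield hq)}
    (hf : Irreducible f) {a b : ordSubfield hq}
    (hab : let _ := ordLinearOrder hq; f.eval a * f.eval b < 0) {θ : C}
    (hθ : Polynomial.aeval θ f = 0) : θ ∈ ordSubfield hq := by
  classical
  let _ := ordLinearOrder hq
  have := ordLinearOrder_isStrictOrderedRing hq
  have hcoe : ∀ x : ordSubfield hq, algebraMap (ordSubfield hq) C x = x := fun _ => rfl
  have hmin : ∀ g : Polynomial (ordSubfield hq), Polynomial.aeval θ g = 0 → f ∣ g := by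
    intro g hg
    by_contra hn
    obtain ⟨u, v, huv⟩ := (hf.coprime_iff_not_dvd).2 hn
    have := congrArg (Polynomial.aeval θ) huv
    simp [hθ, hg] at this
  let B : Subring C := (Polynomial.aeval (R := ordSubfield hq) θ).toRingHom.range
  let M : Submonoid C :=
    { carrier := {c | ∃ p ∈ q.2, ∃ g : Polynomial (ordSubfield hq),
        c = p * Polynomial.aeval θ g ^ 2}
      mul_mem' := by
        rintro _ _ ⟨p, hp, g, rfl⟩ ⟨p', hp', g', rfl⟩
        exact ⟨p * p', mul_mem hp hp', g * g', by rw [map_mul]; ring⟩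
      one_mem' := ⟨1, one_mem _, 1, by simp⟩ }
  have hT : ∀ t ∈ M.subsemiringClosure, ∃ (ι : Type) (_ : Fintype ι) (p : ι → ordSubfield hq)
      (g : ι → Polynomial (ordSubfield hq)), (∀ i, 0 < p i) ∧
        t = ∑ i, (p i : C) * Polynomial.aeval θ (g i) ^ 2 := by
    intro t ht
    rw [Submonoid.subsemiringClosure_mem] at ht
    induction ht using AddSubmonoid.closure_induction with
    | mem x hx =>
      obtain ⟨p, hp, g, rfl⟩ := hx
      by_cases hp0 : p = 0
      · exact ⟨Empty, inferInstance, nofun, nofun, nofun, by simp [hp0]⟩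
      · refine ⟨Unit, inferInstance, fun _ => ⟨p, hq.1.mem_ring p hp⟩, fun _ => g, fun _ => ?_,
          by simp⟩
        refine lt_of_le_of_ne ((ord_nonneg_iff hq _).2 hp) fun h => hp0 ?_
        exact congrArg Subtype.val h.symm
    | zero => exact ⟨Empty, inferInstance, nofun, nofun, nofun, by simp⟩
    | add x y _ _ hx hy =>
      obtain ⟨ι, _, p, g, hp, rfl⟩ := hx
      obtain ⟨κ, _, p', g', hp', rfl⟩ := hy
      exact ⟨ι ⊕ κ, inferInstance, Sum.elim p p', Sum.elim g g', by
        rintro (i | i)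
        · exact hp i
        · exact hp' i, by simp [Fintype.sum_sum_type]⟩
  have hp : OrdPair (B, M.subsemiringClosure) := by
    refine ⟨fun t ht => ?_, ?_, fun t ht ht' => ?_⟩
    · obtain ⟨ι, _, p, g, -, rfl⟩ := hT t ht
      exact ⟨∑ i, Polynomial.C (p i) * g i ^ 2, by simp; rfl⟩
    · rintro _ ⟨g, rfl⟩
      rw [Submonoid.subsemiringClosure_mem]
      exact AddSubmonoid.subset_closure ⟨1, one_mem _, g, by simp [sq]⟩
    · obtain ⟨ι, _, p, g, hp, ht1⟩ := hT t ht
      obtain ⟨κ, _, p', g', hp', ht2⟩ := hT _ ht'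
      have hz := hf.dvd_of_dvd_sum_sq hab (p := Sum.elim p p') (by
        rintro (i | i)
        · exact hp i
        · exact hp' i) (g := Sum.elim g g') (hmin _ (by
          have h0 : t + -t = 0 := add_neg_cancel t
          conv_lhs at h0 => rw [ht2]
          rw [ht1] at h0
          simpa [Fintype.sum_sum_type, hcoe] using h0))
      rw [ht1]
      refine Finset.sum_eq_zero fun i _ => ?_
      obtain ⟨w, hw⟩ := hz (Sum.inl i)
      have : g i = f * w := hw
      rw [this, map_mul, hθ]
      ring
  have hle : q ≤ (B, M.subsemiringClosure) := by
    refine ⟨fun c hc => ⟨Polynomial.C ⟨c, hc⟩, by simp; rfl⟩, fun c hc => ?_⟩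
    change c ∈ M.subsemiringClosure
    rw [Submonoid.subsemiringClosure_mem]
    exact AddSubmonoid.subset_closure ⟨c, hc, 1, by simp⟩
  exact (hq.2 hp hle).1 ⟨Polynomial.X, by simp⟩

lemma ord_polyIVT [IsAlgClosed C] (hq : Maximal OrdPair q) :
    let _ := ordLinearOrder hq
    PolyIVT (ordSubfield hq) := by
  intro _
  have := ordLinearOrder_isStrictOrderedRing hq
  intro p a b hab h
  obtain ⟨f, hf, hfp, hfs⟩ := exists_irreducible_factor_mul_eval_neg h
  obtain ⟨θ, hθ⟩ := IsAlgClosed.exists_aeval_eq_zero C f (by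
    have := Polynomial.degree_pos_of_irreducible hf
    exact this.ne')
  have hmem := ord_root_mem hq hf hfs hθ
  set c : ordSubfield hq := ⟨θ, hmem⟩ with hc
  have hfc : f.eval c = 0 := by
    have h1 : algebraMap (ordSubfield hq) C c = θ := rfl
    rw [← h1, Polynomial.aeval_algebraMap_apply] at hθ
    simpa using hθ
  obtain ⟨w, hw⟩ := Polynomial.dvd_iff_isRoot.2 (show f.IsRoot c from hfc)
  have hwu := (hf.isUnit_or_isUnit hw).resolve_left (Polynomial.not_isUnit_X_sub_C c)
  obtain ⟨r, hr, rfl⟩ := Polynomial.isUnit_iff.1 hwu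
  have hr0 : 0 < r * r := mul_self_pos.2 hr.ne_zero
  have hneg : (a - c) * (b - c) < 0 := by
    rw [hw] at hfs
    simp only [Polynomial.eval_mul, Polynomial.eval_sub, Polynomial.eval_X,
      Polynomial.eval_C] at hfs
    rw [mul_mul_mul_comm] at hfs
    by_contra hn
    exact absurd (mul_nonneg (not_lt.1 hn) hr0.le) (not_le.2 hfs)
  refine ⟨c, ?_, ?_, ?_⟩
  · rcases mul_neg_iff.1 hneg with h | h <;> linarith
  · rcases mul_neg_iff.1 hneg with h | h <;> linarith
  · obtain ⟨v, hv⟩ := hfp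
    rw [hv, Polynomial.eval_mul, hfc, zero_mul]

end OrdPair

section Positivstellensatz

/-- A preordering that contains no `-p ^ (2 * k)`. -/
structure PreorderAvoids {A : Type} [CommRing A] (p : A) (T : Subsemiring A) : Prop where
  sq_mem : ∀ a, a * a ∈ T
  neg_pow_notMem : ∀ k, -(p ^ (2 * k)) ∉ T

namespace PreorderAvoids

variable {A : Type} [CommRing A] {p : A}

lemma exists_maximal {T : Subsemiring A} (hT : PreorderAvoids p T) :
    ∃ P, T ≤ P ∧ Maximal (PreorderAvoids p) P := by
  refine zorn_le_nonempty₀ {P | PreorderAvoids p P} (fun c hc hchain P hP => ?_) T hT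
  have hm : ∀ x, x ∈ sSup c ↔ ∃ z ∈ c, x ∈ z := fun x =>
    Subsemiring.mem_sSup_of_directedOn ⟨P, hP⟩ hchain.directedOn
  refine ⟨sSup c, ⟨fun a => (hm _).2 ⟨P, hP, (hc hP).sq_mem a⟩, fun k hk => ?_⟩,
    fun s hs => le_sSup hs⟩
  obtain ⟨z, hz, h⟩ := (hm _).1 hk
  exact (hc hz).neg_pow_notMem k h

variable {P : Subsemiring A}

lemma pow_mem (hP : PreorderAvoids p P) (k : ℕ) : p ^ (2 * k) ∈ P := by
  rw [two_mul, pow_add]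
  exact hP.sq_mem _

lemma exists_eq_of_notMem (hP : Maximal (PreorderAvoids p) P) {a : A} (ha : a ∉ P) :
    ∃ k, ∃ s ∈ P, ∃ t ∈ P, -(p ^ (2 * k)) = s + a * t := by
  let T : Subsemiring A :=
    { carrier := {c | ∃ t₁ ∈ P, ∃ t₂ ∈ P, c = t₁ + a * t₂}
      mul_mem' := by
        rintro _ _ ⟨t₁, h1, t₂, h2, rfl⟩ ⟨t₃, h3, t₄, h4, rfl⟩
        exact ⟨t₁ * t₃ + (a * a) * (t₂ * t₄), add_mem (mul_mem h1 h3)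
          (mul_mem (hP.1.sq_mem a) (mul_mem h2 h4)), t₁ * t₄ + t₂ * t₃,
          add_mem (mul_mem h1 h4) (mul_mem h2 h3), by ring⟩
      one_mem' := ⟨1, one_mem _, 0, zero_mem _, by ring⟩
      add_mem' := by
        rintro _ _ ⟨t₁, h1, t₂, h2, rfl⟩ ⟨t₃, h3, t₄, h4, rfl⟩
        exact ⟨t₁ + t₃, add_mem h1 h3, t₂ + t₄, add_mem h2 h4, by ring⟩
      zero_mem' := ⟨0, zero_mem _, 0, zero_mem _, by ring⟩ }
  by_contra! hcon
  have hT : PreorderAvoids p T := by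
    refine ⟨fun b => ⟨b * b, hP.1.sq_mem b, 0, zero_mem _, by ring⟩, ?_⟩
    rintro k ⟨s, hs, t, ht, h⟩
    exact hcon k s hs t ht h
  exact ha (hP.2 hT (fun c hc => ⟨c, hc, 0, zero_mem _, by ring⟩)
    ⟨0, zero_mem _, 1, one_mem _, by ring⟩)

lemma mul_aux (hP : Maximal (PreorderAvoids p) P) {a b : A} (ha : a ∉ P) (hb : b ∉ P) :
    -(a * b) ∉ P := by
  intro hab
  obtain ⟨k, s, hs, t, ht, h1⟩ := exists_eq_of_notMem hP ha
  obtain ⟨l, s', hs', t', ht', h2⟩ := exists_eq_of_notMem hP hb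
  apply hP.1.neg_pow_notMem (k + l)
  have : -(p ^ (2 * (k + l))) = -(a * b) * (t * t') + s * p ^ (2 * l) + s' * p ^ (2 * k) +
      s * s' := by
    rw [mul_add, pow_add]
    linear_combination (p ^ (2 * l) + s') * h1 - a * t * h2
  rw [this]
  exact add_mem (add_mem (add_mem (mul_mem hab (mul_mem ht ht'))
    (mul_mem hs (hP.1.pow_mem l))) (mul_mem hs' (hP.1.pow_mem k))) (mul_mem hs hs')

lemma mem_or_neg_mem (hP : Maximal (PreorderAvoids p) P) (a : A) : a ∈ P ∨ -a ∈ P := by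
  by_contra! hcon
  exact mul_aux hP hcon.1 hcon.2 (by simpa using hP.1.sq_mem a)

/-- The support of a maximal preordering avoiding `p`. -/
def support (hP : Maximal (PreorderAvoids p) P) : Ideal A where
  carrier := {a | a ∈ P ∧ -a ∈ P}
  add_mem' := fun ⟨h1, h2⟩ ⟨h3, h4⟩ => ⟨add_mem h1 h3, by rw [neg_add]; exact add_mem h2 h4⟩
  zero_mem' := ⟨zero_mem _, by rw [neg_zero]; exact zero_mem _⟩
  smul_mem' := by
    rintro c a ⟨h1, h2⟩
    rcases mem_or_neg_mem hP c with hc | hc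
    · exact ⟨mul_mem hc h1, by rw [smul_eq_mul, ← mul_neg]; exact mul_mem hc h2⟩
    · refine ⟨?_, by rw [smul_eq_mul, ← neg_mul]; exact mul_mem hc h1⟩
      rw [smul_eq_mul, ← neg_mul_neg]
      exact mul_mem hc h2

lemma mem_support (hP : Maximal (PreorderAvoids p) P) {a : A} :
    a ∈ support hP ↔ a ∈ P ∧ -a ∈ P := Iff.rfl

lemma notMem_support (hP : Maximal (PreorderAvoids p) P) : p ∉ support hP := by
  rintro ⟨h1, h2⟩
  apply hP.1.neg_pow_notMem 1
  have : -(p ^ (2 * 1)) = p * -p := by ring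
  rw [this]
  exact mul_mem h1 h2

lemma support_isPrime (hP : Maximal (PreorderAvoids p) P) : (support hP).IsPrime := by
  refine ⟨fun h => ?_, fun {a b} hab => ?_⟩
  · have := (mem_support hP).1 ((Ideal.eq_top_iff_one _).1 h)
    exact hP.1.neg_pow_notMem 0 (by simpa using this.2)
  · by_contra! hcon
    have key : ∀ a, a ∉ support hP → ∃ a', a' ∉ P ∧ (a' = a ∨ a' = -a) := by
      intro a ha
      rw [mem_support, not_and_or] at ha
      rcases ha with h | h
      · exact ⟨a, h, Or.inl rfl⟩
      · exact ⟨-a, h, Or.inr rfl⟩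
    obtain ⟨a', ha', ha⟩ := key a hcon.1
    obtain ⟨b', hb', hb⟩ := key b hcon.2
    refine mul_aux hP ha' hb' ?_
    rcases ha with rfl | rfl <;> rcases hb with rfl | rfl
    · exact hab.2
    · simpa using hab.1
    · simpa using hab.1
    · simpa using hab.2

end PreorderAvoids

variable {σ : Type} [Finite σ]

/-- The Krivine-Stengle Positivstellensatz. -/
theorem exists_neg_pow_mem_of_eval_eq_zero (T : Subsemiring (MvPolynomial σ ℝ))
    (hT : ∀ a, a * a ∈ T) (G H : Finset (MvPolynomial σ ℝ)) (hG : ∀ g ∈ G, g ∈ T)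
    (hH : ∀ h ∈ H, h ∈ T ∧ -h ∈ T) (p : MvPolynomial σ ℝ)
    (hp : ∀ a : σ → ℝ, (∀ g ∈ G, 0 ≤ eval a g) → (∀ h ∈ H, eval a h = 0) → eval a p = 0) :
    ∃ k, -(p ^ (2 * k)) ∈ T := by
  classical
  by_contra! hcon
  obtain ⟨P, hTP, hP⟩ := PreorderAvoids.exists_maximal ⟨hT, hcon⟩
  set I := PreorderAvoids.support hP with hI
  have : I.IsPrime := PreorderAvoids.support_isPrime hP
  let D := MvPolynomial σ ℝ ⧸ I
  let Ω := AlgebraicClosure (FractionRing D)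
  let ι : MvPolynomial σ ℝ →+* Ω := ((algebraMap (FractionRing D) Ω).comp
    (algebraMap D (FractionRing D))).comp (Ideal.Quotient.mk I)
  have hι : ∀ a, ι a = 0 ↔ a ∈ I := by
    intro a
    change algebraMap (FractionRing D) Ω (algebraMap D (FractionRing D) (Ideal.Quotient.mk I a)) = 0
      ↔ _
    rw [map_eq_zero, map_eq_zero_iff _ (IsFractionRing.injective D (FractionRing D)),
      Ideal.Quotient.eq_zero_iff_mem]
  have hq0 : OrdPair (ι.range, P.map ι) := by
    refine ⟨?_, ?_, ?_⟩
    · rintro _ ⟨t, -, rfl⟩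
      exact ⟨t, rfl⟩
    · rintro _ ⟨b, rfl⟩
      exact ⟨b * b, hP.1.sq_mem b, map_mul ι b b⟩
    · rintro _ ⟨t, ht, rfl⟩ ⟨s, hs, h⟩
      have h1 : s + t ∈ I := (hι _).1 (by rw [map_add, h, neg_add_cancel])
      refine (hι t).2 ⟨ht, ?_⟩
      have h2 := add_mem hs h1.2
      simpa using h2
  obtain ⟨q, hle, hq⟩ := hq0.exists_maximal
  let _ := ordLinearOrder hq
  have := ordLinearOrder_isStrictOrderedRing hq
  let κ : MvPolynomial σ ℝ →+* ordSubfield hq := ι.codRestrict (ordSubfield hq)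
    fun a => hle.1 ⟨a, rfl⟩
  have hκ : ∀ a, κ a = 0 ↔ a ∈ I := fun a => by
    rw [← hι]
    exact Subtype.ext_iff
  have hκP : ∀ a ∈ P, 0 ≤ κ a := fun a ha => (ord_nonneg_iff hq _).2 (hle.2 ⟨a, ha, rfl⟩)
  obtain ⟨a, ha⟩ := artin_lang (ord_polyIVT hq) (κ.comp MvPolynomial.C) (κ ∘ X)
    (G.image (fun g => -g) ∪ (H ∪ H.image (fun h => -h)) ∪ {p, -p})
  have hev : ∀ r, eval₂ (κ.comp MvPolynomial.C) (κ ∘ X) r = κ r := fun r => by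
    rw [← MvPolynomial.eval₂_comp_left, MvPolynomial.eval₂_eta]
  simp only [hev] at ha
  have hz : ∀ r, (0 < κ r ↔ 0 < eval a r) → (0 < κ (-r) ↔ 0 < eval a (-r)) →
      (κ r = 0 ↔ eval a r = 0) := by
    intro r h1 h2
    rw [map_neg, map_neg, neg_pos, neg_pos] at h2
    constructor <;> intro h <;> apply le_antisymm
    · exact not_lt.1 (h1.not.1 (by rw [h]; exact lt_irrefl _))
    · exact not_lt.1 (h2.not.1 (by rw [h]; exact lt_irrefl _))
    · exact not_lt.1 (h1.not.2 (by rw [h]; exact lt_irrefl _))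
    · exact not_lt.1 (h2.not.2 (by rw [h]; exact lt_irrefl _))
  have hpa := hp a (fun g hg => by
    have h1 := ha (-g) (by simp [hg])
    rw [map_neg, map_neg, neg_pos, neg_pos] at h1
    exact not_lt.1 (h1.not.1 (not_lt.2 (hκP g (hTP (hG g hg)))))) (fun h hh => by
    refine (hz h (ha h (by simp [hh])) (ha (-h) (by simp [hh]))).1 ((hκ h).2 ?_)
    exact ⟨hTP (hH h hh).1, hTP (hH h hh).2⟩)
  exact PreorderAvoids.notMem_support hP
    ((hκ p).1 ((hz p (ha p (by simp)) (ha (-p) (by simp))).2 hpa))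

end Positivstellensatz

section QuadraticModule

/-- A quadratic module of a real commutative algebra. -/
structure IsQuadraticModule {A : Type*} [CommRing A] (M : Set A) : Prop where
  one_mem : 1 ∈ M
  add_mem : ∀ {a b}, a ∈ M → b ∈ M → a + b ∈ M
  sq_mul_mem : ∀ (a : A) {b}, b ∈ M → a ^ 2 * b ∈ M

namespace IsQuadraticModule

variable {A : Type*} [CommRing A] [Algebra ℝ A] {M : Set A}

theorem sq_mem (hM : IsQuadraticModule M) (a : A) : a ^ 2 ∈ M := by
  simpa using hM.sq_mul_mem a hM.one_mem

theorem zero_mem (hM : IsQuadraticModule M) : (0 : A) ∈ M := by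
  simpa using hM.sq_mem 0

theorem smul_mem (hM : IsQuadraticModule M) {r : ℝ} (hr : 0 ≤ r) {a : A} (ha : a ∈ M) :
    r • a ∈ M := by
  have := hM.sq_mul_mem (algebraMap ℝ A (Real.sqrt r)) ha
  rwa [← map_pow, Real.sq_sqrt hr, ← Algebra.smul_def] at this

theorem algebraMap_mem (hM : IsQuadraticModule M) {r : ℝ} (hr : 0 ≤ r) : algebraMap ℝ A r ∈ M := by
  simpa [Algebra.algebraMap_eq_smul_one] using hM.smul_mem hr hM.one_mem

theorem sum_mem (hM : IsQuadraticModule M) {ι : Type*} (s : Finset ι) (v : ι → A)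
    (h : ∀ i ∈ s, v i ∈ M) :
    ∑ i ∈ s, v i ∈ M := by
  classical
  induction s using Finset.induction_on with
  | empty => simpa using hM.zero_mem
  | insert i s hi ih =>
    rw [Finset.sum_insert hi]
    exact hM.add_mem (h i (by simp)) (ih fun j hj => h j (by simp [hj]))

theorem isSumSq_mul_mem (hM : IsQuadraticModule M) {s b : A} (hs : IsSumSq s) (hb : b ∈ M) :
    s * b ∈ M := by
  induction hs with
  | zero => simpa using hM.zero_mem
  | sq_add a _ ih =>
    rw [add_mul, ← pow_two]
    exact hM.add_mem (hM.sq_mul_mem a hb) ih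

theorem mul_mem_of_mem_of_neg_mem (hM : IsQuadraticModule M) (a : A) {x : A} (hx : x ∈ M)
    (hx' : -x ∈ M) : a * x ∈ M := by
  have h := hM.add_mem (hM.sq_mul_mem ((1 / 2 : ℝ) • (a + 1)) hx)
    (hM.sq_mul_mem ((1 / 2 : ℝ) • (a - 1)) hx')
  convert h using 1
  have h2 : algebraMap ℝ A (1 / 2) * 2 = 1 := by
    rw [← map_ofNat (algebraMap ℝ A) 2, ← map_mul]; norm_num
  simp only [Algebra.smul_def]
  linear_combination (-(a * x) * (1 + 2 * algebraMap ℝ A (1 / 2))) * h2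

theorem sq_sub_sq_mem (hM : IsQuadraticModule M) {N : ℝ} (hN : 0 < N) {a : A}
    (h1 : algebraMap ℝ A N - a ∈ M)
    (h2 : algebraMap ℝ A N + a ∈ M) : algebraMap ℝ A (N ^ 2) - a ^ 2 ∈ M := by
  have h := hM.smul_mem (r := 1 / (2 * N)) (by positivity)
    (hM.add_mem (hM.sq_mul_mem (algebraMap ℝ A N - a) h2)
      (hM.sq_mul_mem (algebraMap ℝ A N + a) h1))
  convert h using 1
  have h3 : algebraMap ℝ A (1 / (2 * N)) * (2 * algebraMap ℝ A N) = 1 := by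
    rw [← map_ofNat (algebraMap ℝ A) 2, ← map_mul, ← map_mul, one_div_mul_cancel (by positivity),
      map_one]
  rw [Algebra.smul_def, map_pow]
  linear_combination (-(algebraMap ℝ A N ^ 2 - a ^ 2)) * h3

/-- The subalgebra of elements bounded with respect to a quadratic module. -/
def boundedElements (hM : IsQuadraticModule M) : Subalgebra ℝ A where
  carrier := {a | ∃ N : ℝ, 0 < N ∧ algebraMap ℝ A N - a ∈ M ∧ algebraMap ℝ A N + a ∈ M}
  add_mem' := by
    rintro a b ⟨N, hN, h1, h2⟩ ⟨N', hN', h1', h2'⟩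
    refine ⟨N + N', by positivity, ?_, ?_⟩ <;> rw [map_add]
    · convert hM.add_mem h1 h1' using 1; ring
    · convert hM.add_mem h2 h2' using 1; ring
  algebraMap_mem' r := by
    refine ⟨|r| + 1, by positivity, ?_, ?_⟩
    · rw [← map_sub]; exact hM.algebraMap_mem (by linarith [le_abs_self r])
    · rw [← map_add]; exact hM.algebraMap_mem (by linarith [neg_abs_le r])
  mul_mem' := by
    have hsq : ∀ a N, 0 < N → algebraMap ℝ A N - a ∈ M → algebraMap ℝ A N + a ∈ M →
        algebraMap ℝ A (N ^ 2) - a ^ 2 ∈ M := fun a N hN => hM.sq_sub_sq_mem hN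
    rintro a b ⟨N, hN, h1, h2⟩ ⟨N', hN', h1', h2'⟩
    have e1 := hsq (a + b) (N + N') (by positivity)
      (by rw [map_add]; convert hM.add_mem h1 h1' using 1; ring)
      (by rw [map_add]; convert hM.add_mem h2 h2' using 1; ring)
    have e2 := hsq (a - b) (N + N') (by positivity)
      (by rw [map_add]; convert hM.add_mem h1 h2' using 1; ring)
      (by rw [map_add]; convert hM.add_mem h2 h1' using 1; ring)
    have h4 : algebraMap ℝ A (1 / 4) * 4 = 1 := by
      rw [← map_ofNat (algebraMap ℝ A) 4, ← map_mul]; norm_num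
    refine ⟨(1 / 4) * (N + N') ^ 2, by positivity, ?_, ?_⟩
    · convert hM.smul_mem (r := 1 / 4) (by norm_num) (hM.add_mem e1 (hM.sq_mem (a - b))) using 1
      rw [map_mul, Algebra.smul_def]
      linear_combination (a * b) * h4
    · convert hM.smul_mem (r := 1 / 4) (by norm_num) (hM.add_mem e2 (hM.sq_mem (a + b))) using 1
      rw [map_mul, Algebra.smul_def]
      linear_combination (-a * b) * h4

theorem mem_boundedElements_of_sub_sq_mem (hM : IsQuadraticModule M) {R : ℝ} {a : A}
    (h : algebraMap ℝ A R - a ^ 2 ∈ M) : a ∈ hM.boundedElements := by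
  have h4 : algebraMap ℝ A (1 / 2) * 2 = 1 := by
    rw [← map_ofNat (algebraMap ℝ A) 2, ← map_mul]; norm_num
  have h5 := hM.algebraMap_mem (r := 1 - R + |R|) (by linarith [le_abs_self R])
  refine ⟨|R| + 1 + (1 / 2) ^ 2, by positivity, ?_, ?_⟩
  · convert hM.add_mem h5 (hM.add_mem h (hM.sq_mem (a - algebraMap ℝ A (1 / 2)))) using 1
    simp only [map_add, map_sub, map_pow, map_one]
    linear_combination a * h4
  · convert hM.add_mem h5 (hM.add_mem h (hM.sq_mem (a + algebraMap ℝ A (1 / 2)))) using 1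
    simp only [map_add, map_sub, map_pow, map_one]
    linear_combination (-a) * h4

theorem exists_maximal (hM : IsQuadraticModule M) (h1 : (-1 : A) ∉ M) :
    ∃ N : Set A, M ⊆ N ∧ IsQuadraticModule N ∧
    (-1 : A) ∉ N ∧ ∀ N', IsQuadraticModule N' → (-1 : A) ∉ N' → N ⊆ N' → N' ⊆ N := by
  have hchain : ∀ c ⊆ {N : Set A | IsQuadraticModule N ∧ (-1 : A) ∉ N}, IsChain (· ⊆ ·) c →
      c.Nonempty → ∃ ub ∈ {N : Set A | IsQuadraticModule N ∧ (-1 : A) ∉ N}, ∀ s ∈ c, s ⊆ ub := by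
    rintro c hc hchain ⟨N₀, hN₀⟩
    refine ⟨⋃₀ c, ⟨⟨⟨N₀, hN₀, (hc hN₀).1.one_mem⟩, ?_, ?_⟩, ?_⟩,
      fun s hs => Set.subset_sUnion_of_mem hs⟩
    · rintro a b ⟨S, hS, ha⟩ ⟨S', hS', hb⟩
      rcases hchain.total hS hS' with h | h
      · exact ⟨S', hS', (hc hS').1.add_mem (h ha) hb⟩
      · exact ⟨S, hS, (hc hS).1.add_mem ha (h hb)⟩
    · rintro a b ⟨S, hS, hb⟩
      exact ⟨S, hS, (hc hS).1.sq_mul_mem a hb⟩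
    · rintro ⟨S, hS, h⟩
      exact (hc hS).2 h
  obtain ⟨N, hMN, hN⟩ := zorn_subset_nonempty _ hchain M ⟨hM, h1⟩
  exact ⟨N, hMN, hN.prop.1, hN.prop.2, fun N' h h' hs => hN.le_of_ge ⟨h, h'⟩ hs⟩

theorem adjoin (hM : IsQuadraticModule M) (a : A) :
    IsQuadraticModule {x | ∃ m ∈ M, ∃ s, IsSumSq s ∧ x = m + s * a} where
  one_mem := ⟨1, hM.one_mem, 0, .zero, by ring⟩
  add_mem := by
    rintro _ _ ⟨m, hm, s, hs, rfl⟩ ⟨m', hm', s', hs', rfl⟩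
    exact ⟨_, hM.add_mem hm hm', _, hs.add hs', by ring⟩
  sq_mul_mem := by
    rintro b _ ⟨m, hm, s, hs, rfl⟩
    exact ⟨_, hM.sq_mul_mem b hm, _, (IsSumSq.mul_self b).mul hs, by ring⟩

theorem mem_or_neg_mem_of_maximal (hM : IsQuadraticModule M) (h1 : (-1 : A) ∉ M)
    (hmax : ∀ N', IsQuadraticModule N' → (-1 : A) ∉ N' → M ⊆ N' → N' ⊆ M) (a : A) :
    a ∈ M ∨ -a ∈ M := by
  have key : ∀ b, b ∉ M → ∃ m ∈ M, ∃ s, IsSumSq s ∧ -1 = m + s * b := by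
    intro b hb
    by_contra hcon
    exact hb (hmax _ (hM.adjoin b) hcon (fun x hx => ⟨x, hx, 0, .zero, by ring⟩)
      ⟨0, hM.zero_mem, 1, by simp, by ring⟩)
  by_contra! hcon
  obtain ⟨m, hm, s, hs, h⟩ := key a hcon.1
  obtain ⟨m', hm', s', hs', h'⟩ := key (-a) hcon.2
  have hsm : s ∈ M := by simpa using hM.isSumSq_mul_mem hs hM.one_mem
  have hsm' : s' ∈ M := by simpa using hM.isSumSq_mul_mem hs' hM.one_mem
  have hneg : -s ∈ M := by
    convert hM.add_mem hsm' (hM.add_mem (hM.isSumSq_mul_mem hs hm')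
      (hM.isSumSq_mul_mem hs' hm)) using 1
    linear_combination s' * h + s * h'
  refine h1 ?_
  rw [h, mul_comm]
  exact hM.add_mem hm (hM.mul_mem_of_mem_of_neg_mem a hsm hneg)

/-- `a` is within every positive `ε` of the real number `c`, as seen by `M`. -/
def Approx (_ : IsQuadraticModule M) (a : A) (c : ℝ) : Prop :=
  ∀ ε : ℝ, 0 < ε → a - algebraMap ℝ A (c - ε) ∈ M ∧ algebraMap ℝ A (c + ε) - a ∈ M

variable {hM : IsQuadraticModule M}

theorem Approx.add {a b : A} {c d : ℝ} (ha : hM.Approx a c) (hb : hM.Approx b d) :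
    hM.Approx (a + b) (c + d) := by
  intro ε hε
  have h1 := ha (ε / 2) (by positivity)
  have h2 := hb (ε / 2) (by positivity)
  constructor
  · convert hM.add_mem h1.1 h2.1 using 1
    rw [show c + d - ε = (c - ε / 2) + (d - ε / 2) by ring, map_add]; ring
  · convert hM.add_mem h1.2 h2.2 using 1
    rw [show c + d + ε = (c + ε / 2) + (d + ε / 2) by ring, map_add]; ring

theorem Approx.neg {a : A} {c : ℝ} (ha : hM.Approx a c) : hM.Approx (-a) (-c) := by
  intro ε hε
  refine ⟨?_, ?_⟩
  · convert (ha ε hε).2 using 1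
    rw [show -c - ε = -(c + ε) by ring, map_neg]; ring
  · convert (ha ε hε).1 using 1
    rw [show -c + ε = -(c - ε) by ring, map_neg]; ring

theorem Approx.of_real (r : ℝ) : hM.Approx (algebraMap ℝ A r) r := by
  intro ε hε
  rw [← map_sub, ← map_sub]
  exact ⟨hM.algebraMap_mem (by linarith), hM.algebraMap_mem (by linarith)⟩

theorem Approx.smul_of_pos {a : A} {c r : ℝ} (hr : 0 < r) (ha : hM.Approx a c) :
    hM.Approx (r • a) (r * c) := by
  intro ε hε
  have h := ha (ε / r) (by positivity)
  refine ⟨?_, ?_⟩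
  · convert hM.smul_mem hr.le h.1 using 1
    rw [smul_sub, Algebra.smul_def r (algebraMap ℝ A _), ← map_mul]
    congr 2
    field_simp
  · convert hM.smul_mem hr.le h.2 using 1
    rw [smul_sub, Algebra.smul_def r (algebraMap ℝ A _), ← map_mul]
    congr 2
    field_simp

theorem Approx.smul {a : A} {c : ℝ} (r : ℝ) (ha : hM.Approx a c) :
    hM.Approx (r • a) (r * c) := by
  rcases lt_trichotomy r 0 with h | rfl | h
  · simpa using (ha.smul_of_pos (neg_pos.2 h)).neg
  · simpa using Approx.of_real (hM := hM) 0
  · exact ha.smul_of_pos h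

theorem Approx.sq {a : A} {c : ℝ} (ha : hM.Approx a c) : hM.Approx (a ^ 2) (c ^ 2) := by
  have hz : ∀ b, hM.Approx b 0 → hM.Approx (b ^ 2) 0 := by
    intro b hb ε hε
    have h := hb (Real.sqrt ε) (Real.sqrt_pos.2 hε)
    refine ⟨?_, ?_⟩
    · rw [zero_sub, map_neg, sub_neg_eq_add]
      exact hM.add_mem (hM.sq_mem b) (hM.algebraMap_mem hε.le)
    · rw [zero_add, ← Real.sq_sqrt hε.le]
      refine hM.sq_sub_sq_mem (Real.sqrt_pos.2 hε) ?_ ?_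
      · simpa using h.2
      · simpa [add_comm] using h.1
  have h0 : hM.Approx (a - algebraMap ℝ A c) 0 := by
    simpa [sub_eq_add_neg] using ha.add (Approx.of_real (-c))
  have h1 := ((hz _ h0).add (ha.smul (2 * c))).add (Approx.of_real (-(c ^ 2)))
  convert h1 using 1
  · rw [Algebra.smul_def, map_neg, map_mul, map_ofNat, map_pow]; ring
  · ring

theorem Approx.mul {a b : A} {c d : ℝ} (ha : hM.Approx a c) (hb : hM.Approx b d) :
    hM.Approx (a * b) (c * d) := by
  have h := ((ha.add hb).sq.add (ha.add hb.neg).sq.neg).smul (1 / 4)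
  convert h using 1
  · have h4 : algebraMap ℝ A (1 / 4) * 4 = 1 := by
      rw [← map_ofNat (algebraMap ℝ A) 4, ← map_mul]; norm_num
    rw [Algebra.smul_def]
    linear_combination (-a * b) * h4
  · ring

theorem neg_algebraMap_notMem (hM : IsQuadraticModule M) (h1 : (-1 : A) ∉ M) {r : ℝ} (hr : r < 0) :
    algebraMap ℝ A r ∉ M := by
  intro h
  apply h1
  have := hM.smul_mem (r := -1 / r) (div_nonneg_of_nonpos (by norm_num) hr.le) h
  rwa [Algebra.smul_def, ← map_mul, div_mul_cancel₀ _ hr.ne, map_neg, map_one] at this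

theorem Approx.nonneg (h1 : (-1 : A) ∉ M) {a : A} {c : ℝ} (h : hM.Approx a c) (ha : a ∈ M) :
    0 ≤ c := by
  by_contra! hc
  have := hM.add_mem ha (h (-c / 2) (by linarith)).2
  rw [add_sub_cancel] at this
  exact neg_algebraMap_notMem hM h1 (by linarith) this

theorem Approx.unique (h1 : (-1 : A) ∉ M) {a : A} {c d : ℝ} (h : hM.Approx a c)
    (h' : hM.Approx a d) : c = d := by
  have e1 := (h.add h'.neg).nonneg h1 (by simpa using hM.zero_mem)
  have e2 := (h'.add h.neg).nonneg h1 (by simpa using hM.zero_mem)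
  linarith

theorem exists_approx (h1 : (-1 : A) ∉ M) (hb : hM.boundedElements = ⊤)
    (htot : ∀ a, a ∈ M ∨ -a ∈ M) (a : A) : ∃ c, hM.Approx a c := by
  obtain ⟨N, hN, hN1, hN2⟩ : a ∈ hM.boundedElements := hb ▸ Algebra.mem_top
  set L : Set ℝ := {r | a - algebraMap ℝ A r ∈ M} with hL
  have hne : L.Nonempty := ⟨-N, by rw [hL, Set.mem_ofPred_eq, map_neg]; convert hN2 using 1; ring⟩
  have hbd : BddAbove L := ⟨N, fun r hr => by
    by_contra! hlt
    have := hM.add_mem hr hN1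
    rw [add_comm, sub_add_sub_cancel, ← map_sub] at this
    exact neg_algebraMap_notMem hM h1 (by linarith) this⟩
  refine ⟨sSup L, fun ε hε => ⟨?_, ?_⟩⟩
  · obtain ⟨r, hr, hlt⟩ := exists_lt_of_lt_csSup hne (show sSup L - ε < sSup L by linarith)
    have := hM.add_mem hr (hM.algebraMap_mem (r := r - (sSup L - ε)) (by linarith))
    convert this using 1
    rw [map_sub (algebraMap ℝ A) r]; ring
  · rcases htot (a - algebraMap ℝ A (sSup L + ε)) with h | h
    · have := le_csSup hbd (show sSup L + ε ∈ L from h)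
      linarith
    · simpa using h

theorem exists_algHom_nonneg_of_total (h1 : (-1 : A) ∉ M) (hb : hM.boundedElements = ⊤)
    (htot : ∀ a, a ∈ M ∨ -a ∈ M) : ∃ φ : A →ₐ[ℝ] ℝ, ∀ a ∈ M, 0 ≤ φ a := by
  choose φ hφ using exists_approx (hM := hM) h1 hb htot
  have hc : ∀ r, φ (algebraMap ℝ A r) = r := fun r => (hφ _).unique h1 (.of_real r)
  exact ⟨{ toFun := φ
           map_one' := by simpa using hc 1
           map_mul' := fun a b => (hφ _).unique h1 ((hφ a).mul (hφ b))
           map_zero' := by simpa using hc 0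
           map_add' := fun a b => (hφ _).unique h1 ((hφ a).add (hφ b))
           commutes' := hc }, fun a ha => (hφ a).nonneg h1 ha⟩

theorem exists_algHom_nonneg (h1 : (-1 : A) ∉ M) (hb : hM.boundedElements = ⊤) :
    ∃ φ : A →ₐ[ℝ] ℝ, ∀ a ∈ M, 0 ≤ φ a := by
  obtain ⟨N, hMN, hN, hN1, hmax⟩ := hM.exists_maximal h1
  obtain ⟨φ, hφ⟩ := exists_algHom_nonneg_of_total (hM := hN) hN1 (by
    rw [eq_top_iff, ← hb]
    rintro a ⟨K, hK, h, h'⟩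
    exact ⟨K, hK, hMN h, hMN h'⟩) (hN.mem_or_neg_mem_of_maximal hN1 hmax)
  exact ⟨φ, fun a ha => hφ a (hMN ha)⟩

end IsQuadraticModule

end QuadraticModule

section TranscendentalDerivation

theorem FormallySmooth.exists_ringHom_lift {R K B : Type*} [CommRing R] [Field K]
    [Algebra R K] [Algebra.FormallySmooth R K] [CommRing B] (g : B →+* K)
    (hg : Function.Surjective g) (hnil : IsNilpotent (RingHom.ker g)) (φ : R →+* B)
    (h : g.comp φ = algebraMap R K) :
    ∃ ψ : K →+* B, g.comp ψ = RingHom.id K ∧ ψ.comp (algebraMap R K) = φ := by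
  let _ := φ.toAlgebra
  let g' : B →ₐ[R] K := { g with commutes' := fun r => RingHom.congr_fun h r }
  let ψ := Algebra.FormallySmooth.liftOfSurjective (AlgHom.id R K) g' hg hnil
  refine ⟨ψ.toRingHom, ?_, ?_⟩
  · ext x
    exact Algebra.FormallySmooth.liftOfSurjective_apply (AlgHom.id R K) g' hg hnil x
  · ext x
    exact ψ.commutes x

open scoped IntermediateField.algebraAdjoinAdjoin in
theorem AlgebraicIndependent.formallySmooth_adjoin {F K ι : Type*} [Field F] [CharZero F]
    [Field K] [Algebra F K] {v : ι → K} (hv : IsTranscendenceBasis F v) :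
    Algebra.FormallySmooth (Algebra.adjoin F (Set.range v)) K := by
  have h1 : Algebra.FormallySmooth (Algebra.adjoin F (Set.range v))
      (IntermediateField.adjoin F (Set.range v)) := .of_isLocalization (nonZeroDivisors _)
  have := hv.isAlgebraic_field
  have h2 : Algebra.FormallyEtale (IntermediateField.adjoin F (Set.range v)) K :=
    Algebra.FormallyEtale.of_isSeparable _ K
  exact .comp _ (IntermediateField.adjoin F (Set.range v)) _

theorem exists_derivation_eq_one_of_transcendental {F K : Type*} [Field F] [CharZero F]
    [Field K] [Algebra F K] {x : K} (hx : Transcendental F x) :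
    ∃ D : Derivation F K K, D x = 1 := by
  classical
  obtain ⟨s, hxs, hs⟩ := exists_isTranscendenceBasis_superset (s := {x}) (R := F)
    ((algebraicIndependent_unique_type_iff (ι := ({x} : Set K))).2 hx)
  have hsm := AlgebraicIndependent.formallySmooth_adjoin hs
  let i₀ : s := ⟨x, hxs rfl⟩
  let θ : MvPolynomial s F →ₐ[F] TrivSqZeroExt K K :=
    aeval fun i => TrivSqZeroExt.inl (i : K) + TrivSqZeroExt.inr (if i = i₀ then 1 else 0)
  let φ := θ.comp hs.1.repr
  have hφ : (TrivSqZeroExt.fstHom F K K).comp φ = (Subalgebra.val _) := by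
    rw [← hs.1.aeval_comp_repr, ← AlgHom.comp_assoc]
    congr 1
    ext i
    by_cases hi : i = i₀ <;> simp [θ, hi]
  obtain ⟨ψ, h1, h2⟩ := FormallySmooth.exists_ringHom_lift
    (TrivSqZeroExt.fstHom F K K).toRingHom (fun k => ⟨TrivSqZeroExt.inl k, rfl⟩)
    (by
      refine ⟨2, ?_⟩
      rw [pow_two, Ideal.zero_eq_bot, eq_bot_iff, Ideal.mul_le]
      intro r hr t ht
      have hr' : r.fst = 0 := hr
      have ht' : t.fst = 0 := ht
      rw [Ideal.mem_bot]
      ext <;> simp [hr', ht'])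
    φ.toRingHom (by
      ext r
      exact AlgHom.congr_fun hφ r)
  have hfst : ∀ k, (ψ k).fst = k := fun k => RingHom.congr_fun h1 k
  have hF : ∀ c : F, ψ (algebraMap F K c) = algebraMap F (TrivSqZeroExt K K) c := fun c => by
    have := RingHom.congr_fun h2 (algebraMap F _ c)
    exact this.trans (φ.commutes c)
  have hψx : (ψ x).snd = 1 := by
    have := RingHom.congr_fun h2 (hs.1.aevalEquiv (X i₀))
    have e1 : algebraMap (Algebra.adjoin F (Set.range ((↑) : s → K))) K
        (hs.1.aevalEquiv (X i₀)) = x := by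
      rw [AlgebraicIndependent.algebraMap_aevalEquiv, aeval_X]
    have e2 : φ (hs.1.aevalEquiv (X i₀)) = θ (X i₀) := by
      simp [φ, AlgebraicIndependent.repr]
    rw [RingHom.comp_apply, e1] at this
    rw [this]
    exact (congrArg _ e2).trans (by simp [θ])
  let L : K →ₗ[F] K :=
    { toFun := fun k => (ψ k).snd
      map_add' := fun a b => by simp
      map_smul' := fun c k => by
        rw [Algebra.smul_def, map_mul, hF]
        have h3 : (algebraMap F (TrivSqZeroExt K K) c).fst = algebraMap F K c := rfl
        have h4 : (algebraMap F (TrivSqZeroExt K K) c).snd = 0 := rfl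
        simp [h3, h4, Algebra.smul_def] }
  refine ⟨Derivation.mk' L fun a b => ?_, hψx⟩
  change (ψ (a * b)).snd = a * (ψ b).snd + b * (ψ a).snd
  rw [map_mul, TrivSqZeroExt.snd_mul, hfst, hfst]
  simp [mul_comm]

theorem Derivation.apply_mvPolynomial_aeval {F K σ : Type*} [Fintype σ] [Field F] [Field K]
    [Algebra F K] (D : Derivation F K K) (v : σ → K) (p : MvPolynomial σ F) :
    D (aeval v p) = ∑ i, aeval v (pderiv i p) * D (v i) := by
  classical
  induction p using MvPolynomial.induction_on with
  | C a => simp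
  | add p q hp hq => simp [hp, hq, add_mul, Finset.sum_add_distrib]
  | mul_X p j hp =>
    have h : ∀ i, aeval v (pderiv i (p * X j)) * D (v i) =
        aeval v p * (if j = i then D (v i) else 0) + v j * (aeval v (pderiv i p) * D (v i)) := by
      intro i
      rw [Derivation.leibniz, pderiv_X]
      by_cases hij : j = i
      · subst hij
        simp
        ring
      · simp [hij]
        ring
    rw [Finset.sum_congr rfl fun i _ => h i, Finset.sum_add_distrib, ← Finset.mul_sum,
      ← Finset.mul_sum, ← hp, map_mul, aeval_X, Derivation.leibniz]
    simp

end TranscendentalDerivation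

section FritzJohnVariety

variable {n m : ℕ} {f : MvPolynomial (Fin n) ℝ} {g : Fin m → MvPolynomial (Fin n) ℝ}

theorem isAlgebraic_of_aeval_hFJ_eq_zero {K : Type*} [Field K] [Algebra ℝ K]
    {z : Fin n ⊕ Fin (m + 1) → K} (hz : ∀ t, aeval z (hFJ f g t) = 0)
    (h0 : z (Sum.inr 0) ≠ 0) : IsAlgebraic ℝ (aeval z (rename Sum.inl f)) := by
  by_contra hf
  obtain ⟨D, hD⟩ := exists_derivation_eq_one_of_transcendental hf
  have hx := fun i => hz (Sum.inl i)
  have hg := fun j => hz (Sum.inr (Sum.inl j))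
  simp only [hFJ, map_sub, map_sum, map_mul, aeval_X, aeval_rename, sub_eq_zero] at hx hg
  rw [aeval_rename, D.apply_mvPolynomial_aeval] at hD
  have h1 : ∀ j : Fin m, z (Sum.inr j.succ) * D (aeval (z ∘ Sum.inl) (g j)) = 0 := by
    intro j
    rcases mul_eq_zero.1 (hg j) with h | h
    · rw [h, zero_mul]
    · rw [h, map_zero, mul_zero]
  apply h0
  rw [← mul_one (z (Sum.inr 0)), ← hD, Finset.mul_sum]
  simp only [← mul_assoc, hx, Finset.sum_mul]
  rw [Finset.sum_comm]
  refine Finset.sum_eq_zero fun j _ => ?_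
  rw [← h1 j, D.apply_mvPolynomial_aeval, Finset.mul_sum]
  simp only [mul_assoc]

theorem mem_Cset_of_eval_hFJ_eq_zero {z : Fin n ⊕ Fin (m + 1) → ℝ}
    (hz : ∀ t, eval z (hFJ f g t) = 0) (h0 : z (Sum.inr 0) = 0) : z ∘ Sum.inl ∈ Cset g := by
  have hx := fun i => hz (Sum.inl i)
  have hg := fun j => hz (Sum.inr (Sum.inl j))
  have h1 := hz (Sum.inr (Sum.inr ()))
  simp only [hFJ, map_sub, map_sum, map_mul, map_one, eval_X, eval_rename, h0,
    zero_mul, zero_sub, neg_eq_zero, Fin.sum_univ_succ] at hx hg h1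
  refine ⟨fun j => z (Sum.inr j.succ), fun h => ?_, hx, hg⟩
  have h2 : ∀ j : Fin m, z (Sum.inr j.succ) = 0 := fun j => congrFun h j
  simp [h2, h0] at h1

theorem finite_image_eval_hFJ (hfin : ((fun x => eval x f) '' Cset g).Finite) :
    ((fun z => eval z (rename Sum.inl f)) ''
      {z : Fin n ⊕ Fin (m + 1) → ℝ | ∀ t, eval z (hFJ f g t) = 0}).Finite := by
  set A := MvPolynomial (Fin n ⊕ Fin (m + 1)) ℝ
  let I : Ideal A := Ideal.span (Set.range (hFJ f g))
  have hP : ∀ P ∈ I.minimalPrimes, ∃ S : Set ℝ, S.Finite ∧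
      ∀ z : Fin n ⊕ Fin (m + 1) → ℝ, (∀ t, eval z (hFJ f g t) = 0) → P ≤ RingHom.ker (eval z) →
        eval z (rename Sum.inl f) ∈ S := by
    intro P hP
    have hPp : P.IsPrime := hP.1.1
    by_cases h0 : (X (Sum.inr 0) : A) ∈ P
    · refine ⟨_, hfin, fun z hz hle => ⟨z ∘ Sum.inl, mem_Cset_of_eval_hFJ_eq_zero hz ?_, ?_⟩⟩
      · have h := hle h0
        rwa [RingHom.mem_ker, eval_X] at h
      · simp [eval_rename]
    · let K := FractionRing (A ⧸ P)
      let ι : A →ₐ[ℝ] K := (IsScalarTower.toAlgHom ℝ (A ⧸ P) K).comp (Ideal.Quotient.mkₐ ℝ P)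
      have hι : ∀ p, ι p = 0 ↔ p ∈ P := fun p => by
        rw [← Ideal.Quotient.eq_zero_iff_mem]
        exact map_eq_zero_iff _ (IsFractionRing.injective (A ⧸ P) K)
      have hev : ∀ p : A, aeval (ι ∘ X) p = ι p := fun p => by
        rw [← aeval_unique]
      obtain ⟨Q, hQ, hQ0⟩ := isAlgebraic_of_aeval_hFJ_eq_zero (K := K) (f := f) (g := g)
        (z := ι ∘ X) (fun t => by
          rw [hev, hι]
          exact hP.1.2 (Ideal.subset_span ⟨t, rfl⟩)) (fun h => h0 ((hι _).1 h))
      refine ⟨{r | Q.IsRoot r}, Polynomial.finite_setOfPred_isRoot hQ, fun z hz hle => ?_⟩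
      rw [hev, Polynomial.aeval_algHom_apply, hι] at hQ0
      have h : aeval z (Polynomial.aeval (rename Sum.inl f) Q) = 0 := hle hQ0
      rwa [← Polynomial.aeval_algHom_apply] at h
  choose! S hS hSz using hP
  refine (Set.Finite.biUnion (I.finite_minimalPrimes_of_isNoetherianRing A) hS).subset ?_
  rintro _ ⟨z, hz, rfl⟩
  have hker : (RingHom.ker (eval z)).IsPrime := RingHom.ker_isPrime _
  obtain ⟨P, hP, hle⟩ := Ideal.exists_minimalPrimes_le (I := I) (J := RingHom.ker (eval z))
    (Ideal.span_le.2 (by rintro _ ⟨t, rfl⟩; exact hz t))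
  exact Set.mem_biUnion hP (hSz P hP z hz hle)

end FritzJohnVariety

section Certificates

variable {σ ι κ : Type*} [Fintype ι] [Fintype κ]

theorem isSOS_iff_isSumSq {p : MvPolynomial σ ℝ} : IsSOS p ↔ IsSumSq p := by
  constructor
  · rintro ⟨k, q, rfl⟩
    simp only [pow_two]
    exact IsSumSq.sum_mul_self _ _
  · intro h
    induction h with
    | zero => exact ⟨0, Fin.elim0, by simp⟩
    | sq_add a _ ih =>
      obtain ⟨k, q, rfl⟩ := ih
      exact ⟨k + 1, Fin.cons a q, by simp [Fin.sum_univ_succ, pow_two]⟩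

theorem IsSOS.add {p q : MvPolynomial σ ℝ} (hp : IsSOS p) (hq : IsSOS q) : IsSOS (p + q) := by
  rw [isSOS_iff_isSumSq] at *
  exact hp.add hq

theorem IsSOS.mul {p q : MvPolynomial σ ℝ} (hp : IsSOS p) (hq : IsSOS q) : IsSOS (p * q) := by
  rw [isSOS_iff_isSumSq] at *
  exact hp.mul hq

theorem IsSOS.sq (p : MvPolynomial σ ℝ) : IsSOS (p ^ 2) :=
  ⟨1, fun _ => p, by simp⟩

theorem IsSOS.zero : IsSOS (0 : MvPolynomial σ ℝ) :=
  ⟨0, Fin.elim0, by simp⟩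

theorem IsSOS.C {r : ℝ} (hr : 0 ≤ r) : IsSOS (C r : MvPolynomial σ ℝ) := by
  rw [← Real.sq_sqrt hr, map_pow]
  exact IsSOS.sq _

theorem IsSOS.eval_nonneg {p : MvPolynomial σ ℝ} (hp : IsSOS p) (z : σ → ℝ) : 0 ≤ eval z p := by
  obtain ⟨k, q, rfl⟩ := hp
  rw [map_sum]
  exact Finset.sum_nonneg fun i _ => by rw [map_pow]; positivity

theorem InQM.eval_nonneg {G : ι → MvPolynomial σ ℝ} {p : MvPolynomial σ ℝ} (hp : InQM G p)
    {z : σ → ℝ} (hz : ∀ j, 0 ≤ eval z (G j)) : 0 ≤ eval z p := by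
  obtain ⟨s0, s, h0, hs, rfl⟩ := hp
  rw [map_add, map_sum]
  refine add_nonneg (h0.eval_nonneg z) (Finset.sum_nonneg fun j _ => ?_)
  rw [map_mul]
  exact mul_nonneg ((hs j).eval_nonneg z) (hz j)

theorem IsSOS.inQM (G : ι → MvPolynomial σ ℝ) {p : MvPolynomial σ ℝ} (hp : IsSOS p) :
    InQM G p :=
  ⟨p, 0, hp, fun _ => .zero, by simp⟩

theorem InQM.generator (G : ι → MvPolynomial σ ℝ) (i : ι) : InQM G (G i) := by
  classical
  refine ⟨0, Pi.single i 1, .zero, fun j => ?_, by simp [Pi.single_apply]⟩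
  by_cases h : j = i
  · subst h
    simpa using IsSOS.sq (1 : MvPolynomial σ ℝ)
  · simpa [h] using IsSOS.zero

theorem isQuadraticModule_inQM (G : ι → MvPolynomial σ ℝ) (I : Ideal (MvPolynomial σ ℝ)) :
    IsQuadraticModule {q | ∃ b, InQM G b ∧ q - b ∈ I} where
  one_mem := ⟨1, IsSOS.inQM G (by simpa using IsSOS.sq (1 : MvPolynomial σ ℝ)), by simp⟩
  add_mem := by
    rintro a b ⟨_, ⟨s0, s, h0, hs, rfl⟩, ha⟩ ⟨_, ⟨t0, t, h0', ht, rfl⟩, hb⟩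
    refine ⟨_, ⟨s0 + t0, s + t, h0.add h0', fun j => (hs j).add (ht j), rfl⟩, ?_⟩
    convert I.add_mem ha hb using 1
    simp only [Pi.add_apply, add_mul, Finset.sum_add_distrib]
    ring
  sq_mul_mem := by
    rintro a b ⟨_, ⟨s0, s, h0, hs, rfl⟩, hb⟩
    refine ⟨_, ⟨a ^ 2 * s0, fun j => a ^ 2 * s j, (IsSOS.sq a).mul h0,
      fun j => (IsSOS.sq a).mul (hs j), rfl⟩, ?_⟩
    convert I.mul_mem_left (a ^ 2) hb using 1
    simp only [mul_assoc, ← Finset.mul_sum]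
    ring

theorem isQuadraticModule_setOf_inQM (G : ι → MvPolynomial σ ℝ) :
    IsQuadraticModule {q | InQM G q} := by
  have h := isQuadraticModule_inQM G ⊥
  have he : {q | ∃ b, InQM G b ∧ q - b ∈ (⊥ : Ideal (MvPolynomial σ ℝ))} = {q | InQM G q} := by
    ext q
    simp [sub_eq_zero]
  rwa [he] at h

/-- Representation of `-1` from emptiness, in the Archimedean case. -/
theorem exists_inQM_neg_one_sub_mem_of_bounded (G : ι → MvPolynomial σ ℝ)
    (I : Ideal (MvPolynomial σ ℝ))
    (hb : ∀ i, X i ∈ (isQuadraticModule_inQM G I).boundedElements)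
    (hempty : ∀ z : σ → ℝ, (∀ j, 0 ≤ eval z (G j)) → ¬ ∀ p ∈ I, eval z p = 0) :
    ∃ τ, InQM G τ ∧ -1 - τ ∈ I := by
  by_contra hcon
  obtain ⟨φ, hφ⟩ := (isQuadraticModule_inQM G I).exists_algHom_nonneg hcon (by
    rw [eq_top_iff, ← adjoin_range_X, Algebra.adjoin_le_iff]
    rintro _ ⟨i, rfl⟩
    exact hb i)
  have he : ∀ p, φ p = eval (φ ∘ X) p := fun p => by
    conv_lhs => rw [aeval_unique φ]
    rfl
  have hI : ∀ p ∈ I, 0 ≤ φ p := fun p hp => hφ p ⟨0, IsSOS.inQM G .zero, by simpa using hp⟩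
  refine hempty (φ ∘ X) (fun j => ?_) fun p hp => ?_
  · rw [← he]
    exact hφ _ ⟨_, InQM.generator G j, by simp⟩
  · rw [← he]
    refine le_antisymm ?_ (hI p hp)
    simpa using hI (-p) (I.neg_mem hp)

theorem InQM.prod_mul_prod {m : ℕ} (g : Fin m → MvPolynomial σ ℝ) (A B : Finset (Fin m)) :
    InQM (fun A : {A : Finset (Fin m) // A.Nonempty} => ∏ j ∈ A.1, g j)
      ((∏ j ∈ A, g j) * ∏ j ∈ B, g j) := by
  have h : (∏ j ∈ A, g j) * ∏ j ∈ B, g j =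
      (∏ j ∈ A ∩ B, g j) ^ 2 * ∏ j ∈ symmDiff A B, g j := by
    have e : Disjoint (A ∩ B) (symmDiff A B) := by
      rw [Finset.disjoint_left]
      intro x hx hx'
      simp only [Finset.mem_inter, Finset.mem_symmDiff] at hx hx'
      tauto
    have e' : (A ∩ B) ∪ symmDiff A B = A ∪ B := by
      ext x
      simp only [Finset.mem_union, Finset.mem_inter, Finset.mem_symmDiff]
      tauto
    rw [← Finset.prod_union_inter, ← e', Finset.prod_union e]
    ring
  rw [h]
  refine (isQuadraticModule_setOf_inQM _).sq_mul_mem _ ?_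
  by_cases hn : (symmDiff A B).Nonempty
  · exact InQM.generator (fun A : {A : Finset (Fin m) // A.Nonempty} => ∏ j ∈ A.1, g j) ⟨_, hn⟩
  · rw [Finset.not_nonempty_iff_eq_empty.1 hn, Finset.prod_empty]
    exact (isQuadraticModule_setOf_inQM _).one_mem

theorem InQM.mul {m : ℕ} {g : Fin m → MvPolynomial σ ℝ} {p q : MvPolynomial σ ℝ}
    (hp : InQM (fun A : {A : Finset (Fin m) // A.Nonempty} => ∏ j ∈ A.1, g j) p)
    (hq : InQM (fun A : {A : Finset (Fin m) // A.Nonempty} => ∏ j ∈ A.1, g j) q) :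
    InQM (fun A : {A : Finset (Fin m) // A.Nonempty} => ∏ j ∈ A.1, g j) (p * q) := by
  set G := fun A : {A : Finset (Fin m) // A.Nonempty} => ∏ j ∈ A.1, g j with hG
  have hM := isQuadraticModule_setOf_inQM G
  have h1 : ∀ A q, InQM G q → InQM G (G A * q) := by
    rintro A _ ⟨t0, t, h0, ht, rfl⟩
    rw [mul_add, Finset.mul_sum]
    refine hM.add_mem ?_ (hM.sum_mem _ _ fun B _ => ?_)
    · rw [mul_comm]
      exact hM.isSumSq_mul_mem (isSOS_iff_isSumSq.1 h0) (InQM.generator G A)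
    · rw [mul_left_comm]
      exact hM.isSumSq_mul_mem (isSOS_iff_isSumSq.1 (ht B)) (InQM.prod_mul_prod g A.1 B.1)
  obtain ⟨s0, s, h0, hs, rfl⟩ := hp
  rw [add_mul, Finset.sum_mul]
  refine hM.add_mem (hM.isSumSq_mul_mem (isSOS_iff_isSumSq.1 h0) hq)
    (hM.sum_mem _ _ fun A _ => ?_)
  rw [mul_assoc]
  exact hM.isSumSq_mul_mem (isSOS_iff_isSumSq.1 (hs A)) (h1 A q hq)

/-- The subsemiring of elements congruent modulo `I` to members of a multiplicative quadratic
module. -/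
def inQMSubsemiring (G : ι → MvPolynomial σ ℝ) (I : Ideal (MvPolynomial σ ℝ))
    (hmul : ∀ p q, InQM G p → InQM G q → InQM G (p * q)) : Subsemiring (MvPolynomial σ ℝ) where
  carrier := {q | ∃ b, InQM G b ∧ q - b ∈ I}
  mul_mem' := by
    rintro a b ⟨a', ha', ha⟩ ⟨b', hb', hb⟩
    refine ⟨a' * b', hmul _ _ ha' hb', ?_⟩
    convert I.add_mem (I.mul_mem_left b ha) (I.mul_mem_left a' hb) using 1
    ring
  one_mem' := (isQuadraticModule_inQM G I).one_mem
  add_mem' := (isQuadraticModule_inQM G I).add_mem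
  zero_mem' := (isQuadraticModule_inQM G I).zero_mem

theorem exists_inQM_neg_pow_sub_mem {σ ι : Type} [Finite σ] [Fintype ι]
    (G : ι → MvPolynomial σ ℝ) (H : Finset (MvPolynomial σ ℝ))
    (hmul : ∀ p q, InQM G p → InQM G q → InQM G (p * q)) (p : MvPolynomial σ ℝ)
    (hp : ∀ z : σ → ℝ, (∀ j, 0 ≤ eval z (G j)) → (∀ h ∈ H, eval z h = 0) → eval z p = 0) :
    ∃ k τ, InQM G τ ∧ -(p ^ (2 * k)) - τ ∈ Ideal.span (H : Set (MvPolynomial σ ℝ)) := by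
  classical
  have hM := isQuadraticModule_inQM G (Ideal.span (H : Set (MvPolynomial σ ℝ)))
  obtain ⟨k, b, hb⟩ := exists_neg_pow_mem_of_eval_eq_zero
    (inQMSubsemiring G (Ideal.span (H : Set (MvPolynomial σ ℝ))) hmul)
    (fun a => by rw [← pow_two]; exact hM.sq_mem a) (Finset.univ.image G) H
    (fun q hq => by
      obtain ⟨j, -, rfl⟩ := Finset.mem_image.1 hq
      exact ⟨G j, InQM.generator G j, by simp⟩)
    (fun h hh => ⟨⟨0, IsSOS.inQM G .zero, by simpa using Ideal.subset_span hh⟩,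
      ⟨0, IsSOS.inQM G .zero, by simpa using Ideal.subset_span hh⟩⟩) p
    (fun z hz => hp z fun j => hz _ (by simp))
  exact ⟨k, b, hb⟩

theorem exists_isSOS_pow_add_mem {σ : Type} [Finite σ] (H : Finset (MvPolynomial σ ℝ))
    (p : MvPolynomial σ ℝ) (hp : ∀ z : σ → ℝ, (∀ h ∈ H, eval z h = 0) → eval z p = 0) :
    ∃ j s, IsSOS s ∧ p ^ 2 ^ (j + 1) + s ∈ Ideal.span (H : Set (MvPolynomial σ ℝ)) := by
  have hG : ∀ q, InQM (fun i : Empty => (i.elim : MvPolynomial σ ℝ)) q → IsSOS q := by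
    rintro _ ⟨s0, s, h0, -, rfl⟩
    simpa using h0
  obtain ⟨k, τ, hτ, h⟩ := exists_inQM_neg_pow_sub_mem
    (fun i : Empty => (i.elim : MvPolynomial σ ℝ)) H
    (fun p q hp hq => ((hG p hp).mul (hG q hq)).inQM _) p fun z _ => hp z
  have hk : k ≤ 2 ^ k := Nat.lt_two_pow_self.le
  refine ⟨k, (p ^ (2 ^ k - k)) ^ 2 * τ, (IsSOS.sq _).mul (hG τ hτ), ?_⟩
  convert Ideal.mul_mem_left _ (-(p ^ (2 ^ k - k)) ^ 2) h using 1
  have e : p ^ 2 ^ (k + 1) = (p ^ (2 ^ k - k)) ^ 2 * p ^ (2 * k) := by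
    rw [← pow_mul, ← pow_add]
    congr 1
    rw [pow_succ]
    omega
  rw [e]
  ring

end Certificates

section FiniteConvergence

theorem exists_isSOS_add_const_mul_pow {σ : Type*} (p : MvPolynomial σ ℝ) (j : ℕ) {ε : ℝ}
    (hε : 0 < ε) : ∃ a : ℝ, 0 ≤ a ∧ IsSOS (C ε + p + C a * p ^ 2 ^ (j + 1)) ∧
      (C ε + p + C a * p ^ 2 ^ (j + 1)).totalDegree ≤ 2 ^ (j + 1) * p.totalDegree := by
  have hdeg : ∀ i a, (C ε + p + C a * p ^ 2 ^ (i + 1)).totalDegree ≤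
      2 ^ (i + 1) * p.totalDegree := by
    intro i a
    have h1 : p.totalDegree ≤ 2 ^ (i + 1) * p.totalDegree :=
      Nat.le_mul_of_pos_left _ (by positivity)
    refine (totalDegree_add _ _).trans (max_le ((totalDegree_add _ _).trans (max_le ?_ h1)) ?_)
    · rw [totalDegree_C]; positivity
    · refine (totalDegree_mul _ _).trans ?_
      rw [totalDegree_C, zero_add]
      exact totalDegree_pow _ _
  suffices ∃ a : ℝ, 0 ≤ a ∧ IsSOS (C ε + p + C a * p ^ 2 ^ (j + 1)) by
    obtain ⟨a, ha, h⟩ := this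
    exact ⟨a, ha, h, hdeg j a⟩
  clear hdeg
  induction j generalizing ε with
  | zero =>
    refine ⟨1 / (4 * ε), by positivity, ?_⟩
    convert (IsSOS.C hε.le).mul (IsSOS.sq (1 + C (1 / (2 * ε)) * p)) using 1
    have h1 : (C ε : MvPolynomial σ ℝ) * C (1 / (2 * ε)) * 2 = 1 := by
      rw [← map_ofNat (C : ℝ →+* MvPolynomial σ ℝ) 2, ← map_mul, ← map_mul,
        show ε * (1 / (2 * ε)) * 2 = 1 by field_simp, map_one]
    have h2 : (C (1 / (4 * ε)) : MvPolynomial σ ℝ) = C ε * C (1 / (2 * ε)) ^ 2 := by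
      rw [← map_pow, ← map_mul]
      congr 1
      field_simp
      norm_num
    rw [h2]
    linear_combination (-p) * h1
  | succ j ih =>
    obtain ⟨a, ha, h⟩ := ih (half_pos hε)
    refine ⟨a ^ 2 / (2 * ε), by positivity, ?_⟩
    convert h.add ((IsSOS.C (half_pos hε).le).mul
      (IsSOS.sq (1 - C (a / ε) * p ^ 2 ^ (j + 1)))) using 1
    have h1 : (C (ε / 2) : MvPolynomial σ ℝ) * 2 = C ε := by
      rw [← map_ofNat (C : ℝ →+* MvPolynomial σ ℝ) 2, ← map_mul]
      congr 1
      ring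
    have h2 : (C (a ^ 2 / (2 * ε)) : MvPolynomial σ ℝ) = C (ε / 2) * C (a / ε) ^ 2 := by
      rw [← map_pow, ← map_mul]
      congr 1
      field_simp
    have h3 : (C a : MvPolynomial σ ℝ) = 2 * C (ε / 2) * C (a / ε) := by
      rw [← map_ofNat (C : ℝ →+* MvPolynomial σ ℝ) 2, ← map_mul, ← map_mul]
      congr 1
      field_simp
    have h4 : p ^ 2 ^ (j + 1 + 1) = (p ^ 2 ^ (j + 1)) ^ 2 := by
      rw [← pow_mul, pow_succ 2 (j + 1)]
    rw [h2, h3, h4]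
    linear_combination -h1

theorem exists_inQM_eval_eq_sub {σ ι : Type*} [Fintype ι] (F : MvPolynomial σ ℝ)
    (G : ι → MvPolynomial σ ℝ) (I : Ideal (MvPolynomial σ ℝ)) (c : ℝ)
    (hfin : ((fun z => eval z F) '' {z | ∀ p ∈ I, eval z p = 0}).Finite)
    (hneg : ∀ t < c, ∃ τ, InQM G τ ∧ -1 - τ ∈ I ⊔ Ideal.span {F - C t}) :
    ∃ q, InQM G q ∧ ∀ z, (∀ p ∈ I, eval z p = 0) → eval z q = eval z F - c := by
  classical
  have hM := isQuadraticModule_setOf_inQM G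
  have hτ : ∀ t, ∃ τ, InQM G τ ∧
      ∀ z, (∀ p ∈ I, eval z p = 0) → eval z F = t → eval z τ = t - c := by
    intro t
    rcases le_or_gt c t with h | h
    · exact ⟨C (t - c), (IsSOS.C (sub_nonneg.2 h)).inQM G, fun z _ _ => eval_C _⟩
    · obtain ⟨τ, hτ, h2⟩ := hneg t h
      refine ⟨C (c - t) * τ, hM.isSumSq_mul_mem
        (isSOS_iff_isSumSq.1 (IsSOS.C (sub_nonneg.2 h.le))) hτ, fun z hz hzF => ?_⟩
      obtain ⟨x, hx, y, hy, hxy⟩ := Submodule.mem_sup.1 h2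
      obtain ⟨w, rfl⟩ := Ideal.mem_span_singleton'.1 hy
      have h3 := congrArg (eval z) hxy
      simp only [map_add, map_sub, map_mul, map_neg, map_one, hz x hx, hzF, eval_C] at h3
      rw [map_mul, eval_C]
      linear_combination (c - t) * h3
  choose τ hτ1 hτ2 using hτ
  set V := hfin.toFinset
  let e : ℝ → MvPolynomial σ ℝ := fun t => Polynomial.aeval F (Lagrange.basis V id t)
  have he : ∀ z t, eval z (e t) = (Lagrange.basis V id t).eval (eval z F) := by
    intro z t
    have := Polynomial.aeval_algHom_apply (aeval z : MvPolynomial σ ℝ →ₐ[ℝ] ℝ) F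
      (Lagrange.basis V id t)
    exact this.symm
  refine ⟨∑ t ∈ V, e t ^ 2 * τ t, hM.sum_mem _ _ fun t _ => hM.sq_mul_mem _ (hτ1 t),
    fun z hz => ?_⟩
  have hzV : eval z F ∈ V := hfin.mem_toFinset.2 ⟨z, hz, rfl⟩
  rw [map_sum, Finset.sum_eq_single_of_mem _ hzV]
  · rw [map_mul, map_pow, he, hτ2 _ z hz rfl]
    have := Lagrange.eval_basis_self (v := id) (Set.injOn_id _) hzV
    rw [id] at this
    rw [this]
    ring
  · intro t ht hne
    have := Lagrange.eval_basis_of_ne (v := id) hne hzV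
    rw [id] at this
    rw [map_mul, map_pow, he, this]
    ring

theorem exists_order_forall_pos {σ ι κ : Type} [Finite σ] [Fintype ι] [Fintype κ]
    (F : MvPolynomial σ ℝ) (G : ι → MvPolynomial σ ℝ) (h : κ → MvPolynomial σ ℝ) (c : ℝ)
    (hfin : ((fun z => eval z F) '' {z | ∀ t, eval z (h t) = 0}).Finite)
    (hneg : ∀ t < c, ∃ τ, InQM G τ ∧
      -1 - τ ∈ Ideal.span (Set.range h) ⊔ Ideal.span {F - C t}) :
    ∃ k, ∀ ε > 0, ∃ q1 q2, InTruncQM k G q1 ∧ InTruncId k h q2 ∧ F - C (c - ε) = q1 + q2 := by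
  classical
  set I := Ideal.span (Set.range h)
  have hIz : ∀ z : σ → ℝ, (∀ p ∈ I, eval z p = 0) ↔ ∀ t, eval z (h t) = 0 := by
    intro z
    refine ⟨fun hz t => hz _ (Ideal.subset_span ⟨t, rfl⟩), fun hz p hp => ?_⟩
    have : I ≤ RingHom.ker (eval z) := Ideal.span_le.2 (by rintro _ ⟨t, rfl⟩; exact hz t)
    exact this hp
  obtain ⟨q, ⟨q0, s, hq0, hs, hq⟩, hqz⟩ := exists_inQM_eval_eq_sub F G I c
    (by simpa only [hIz] using hfin) hneg
  obtain ⟨j, s', hs', hmem⟩ := exists_isSOS_pow_add_mem (Finset.univ.image h) (F - C c - q)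
    (fun z hz => by
      rw [map_sub, map_sub, eval_C, hqz z ((hIz z).2 fun t => hz _ (by simp)), sub_self])
  set p := F - C c - q with hp
  rw [Finset.coe_image, Finset.coe_univ, Set.image_univ] at hmem
  obtain ⟨ψ, hψ⟩ := Ideal.mem_span_range_iff_exists_fun.1 hmem
  let D := q0.totalDegree + (2 ^ (j + 1) * p.totalDegree + (s'.totalDegree +
    (∑ i, (s i * G i).totalDegree + ∑ t, (ψ t * h t).totalDegree)))
  have hD1 : ∀ i, (s i * G i).totalDegree ≤ ∑ i, (s i * G i).totalDegree := fun i =>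
    Finset.single_le_sum (f := fun i => (s i * G i).totalDegree) (by simp) (Finset.mem_univ i)
  have hD2 : ∀ i, (ψ i * h i).totalDegree ≤ ∑ i, (ψ i * h i).totalDegree := fun i =>
    Finset.single_le_sum (f := fun i => (ψ i * h i).totalDegree) (by simp) (Finset.mem_univ i)
  have hCdeg : ∀ (a : ℝ) (r : MvPolynomial σ ℝ), (C a * r).totalDegree ≤ r.totalDegree :=
    fun a r => (totalDegree_mul _ _).trans (by rw [totalDegree_C, zero_add])
  refine ⟨D, fun ε hε => ?_⟩
  obtain ⟨a, ha, hS, hSdeg⟩ := exists_isSOS_add_const_mul_pow p j hε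
  set S := C ε + p + C a * p ^ 2 ^ (j + 1) with hSdef
  refine ⟨(q0 + (S + C a * s')) + ∑ i, s i * G i, ∑ t, (C (-a) * ψ t) * h t,
    ⟨q0 + (S + C a * s'), s, hq0.add (hS.add ((IsSOS.C ha).mul hs')), hs, ?_, fun i => ?_, rfl⟩,
    ⟨fun t => C (-a) * ψ t, fun t => ?_, rfl⟩, ?_⟩
  · refine (totalDegree_add _ _).trans (max_le (by omega) ((totalDegree_add _ _).trans
      (max_le (by omega) ((hCdeg _ _).trans (by omega)))))
  · exact (hD1 i).trans (by omega)
  · rw [mul_assoc]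
    exact (hCdeg _ _).trans ((hD2 t).trans (by omega))
  · simp only [mul_assoc, ← Finset.mul_sum]
    rw [hψ, hSdef, map_sub, map_neg]
    linear_combination hq - hp

end FiniteConvergence

section FritzJohnConditions

theorem MvPolynomial.hasDerivAt_eval_line {σ : Type*} [Fintype σ] (u d : σ → ℝ)
    (p : MvPolynomial σ ℝ) :
    HasDerivAt (fun t : ℝ => eval (u + t • d) p) (∑ i, eval u (pderiv i p) * d i) 0 := by
  classical
  induction p using MvPolynomial.induction_on with
  | C a => simpa using hasDerivAt_const (0 : ℝ) a
  | add p q hp hq =>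
    have h := hp.add hq
    have hfun : (fun t : ℝ => eval (u + t • d) (p + q)) =
        (fun t => eval (u + t • d) p) + fun t => eval (u + t • d) q := by
      funext t
      simp
    rw [hfun]
    exact h.congr_deriv (by simp [add_mul, Finset.sum_add_distrib])
  | mul_X p j hp =>
    have hX : HasDerivAt (fun t : ℝ => u j + t * d j) (d j) 0 := by
      simpa using ((hasDerivAt_id (0 : ℝ)).mul_const (d j)).const_add (u j)
    have h := hp.mul hX
    have he : ∀ i, eval u (pderiv i (p * X j)) * d i =
        eval u p * (if j = i then d i else 0) + u j * (eval u (pderiv i p) * d i) := by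
      intro i
      rw [Derivation.leibniz, pderiv_X]
      by_cases hij : j = i
      · subst hij
        simp
        ring
      · simp [hij]
        ring
    have hfun : (fun t : ℝ => eval (u + t • d) (p * X j)) =
        (fun t => eval (u + t • d) p) * fun t => u j + t * d j := by
      funext t
      simp
    rw [hfun]
    refine h.congr_deriv ?_
    rw [Finset.sum_congr rfl fun i _ => he i, Finset.sum_add_distrib, ← Finset.mul_sum,
      ← Finset.mul_sum]
    simp
    ring

theorem MvPolynomial.eventually_eval_lt_of_deriv_pos {σ : Type*} [Fintype σ] {u d : σ → ℝ}
    {p : MvPolynomial σ ℝ} (h : 0 < ∑ i, eval u (pderiv i p) * d i) :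
    ∀ᶠ t : ℝ in nhdsWithin 0 (Set.Ioi 0), eval u p < eval (u + t • d) p := by
  have h1 := (hasDerivAt_eval_line u d p).tendsto_slope.eventually (lt_mem_nhds h)
  have h2 := h1.filter_mono (nhdsWithin_mono 0 fun t (ht : 0 < t) => ne_of_gt ht)
  filter_upwards [h2, self_mem_nhdsWithin] with t ht ht0
  have ht0' : 0 < t := ht0
  rw [slope_def_field, sub_zero, zero_smul, add_zero, div_pos_iff_of_pos_right ht0'] at ht
  linarith

theorem exists_fritzJohn_multiplier {n m : ℕ} (f : MvPolynomial (Fin n) ℝ)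
    (g : Fin m → MvPolynomial (Fin n) ℝ) (u : Fin n → ℝ)
    (hu : u ∈ Sg g) (hmin : ∀ x ∈ Sg g, eval u f ≤ eval x f) :
    ∃ lam : Fin (m + 1) → ℝ, lam ≠ 0 ∧
      (∀ i, lam 0 * eval u (pderiv i f) = ∑ j : Fin m, lam j.succ * eval u (pderiv i (g j))) ∧
      ∀ j : Fin m, lam j.succ * eval u (g j) = 0 := by
  classical
  let L : ((Fin n → ℝ) × (Fin m → ℝ)) →ₗ[ℝ] (Fin (m + 1) → ℝ) :=
    { toFun := fun x => Fin.cons (∑ i, eval u (pderiv i f) * x.1 i)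
        fun j => ∑ i, eval u (pderiv i (g j)) * x.1 i + eval u (g j) * x.2 j
      map_add' := fun x y => by
        ext k
        refine Fin.cases ?_ (fun j => ?_) k
        · simp [mul_add, Finset.sum_add_distrib]
        · simp [mul_add, Finset.sum_add_distrib]
          ring
      map_smul' := fun c x => by
        ext k
        refine Fin.cases ?_ (fun j => ?_) k
        · simp [Finset.mul_sum, mul_left_comm]
        · simp [Finset.mul_sum, mul_left_comm, mul_add] }
  have hL0 : ∀ x, L x 0 = ∑ i, eval u (pderiv i f) * x.1 i := fun x => rfl
  have hLs : ∀ x (j : Fin m), L x j.succ =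
    ∑ i, eval u (pderiv i (g j)) * x.1 i + eval u (g j) * x.2 j := fun x j => rfl
  by_cases hsurj : LinearMap.range L = ⊤
  · exfalso
    obtain ⟨⟨d, y⟩, hdy⟩ := LinearMap.range_eq_top.1 hsurj (Fin.cons (-1) fun _ => 1)
    have hf : 0 < ∑ i, eval u (pderiv i (-f)) * d i := by
      have := congrFun hdy 0
      rw [hL0, Fin.cons_zero] at this
      simp [this]
    have hg : ∀ j, ∀ᶠ t : ℝ in nhdsWithin 0 (Set.Ioi 0), 0 ≤ eval (u + t • d) (g j) := by
      intro j
      rcases (hu j).eq_or_lt with h0 | h0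
      · have := congrFun hdy j.succ
        rw [hLs, Fin.cons_succ, ← h0, zero_mul, add_zero] at this
        filter_upwards [eventually_eval_lt_of_deriv_pos (p := g j) (by rw [this]; norm_num)]
          with t ht
        linarith
      · have hc := (hasDerivAt_eval_line u d (g j)).continuousAt
        have h1 : ∀ᶠ t : ℝ in nhds 0, 0 < eval (u + t • d) (g j) :=
          hc.eventually (lt_mem_nhds (by simpa using h0))
        filter_upwards [h1.filter_mono nhdsWithin_le_nhds] with t ht using ht.le
    obtain ⟨t, ht, ht'⟩ :=
      ((eventually_eval_lt_of_deriv_pos hf).and (Filter.eventually_all.2 hg)).exists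
    have := hmin _ ht'
    rw [map_neg, map_neg] at ht
    linarith
  · obtain ⟨μ, hμ0, hμ⟩ := Submodule.exists_le_ker_of_lt_top _ (lt_top_iff_ne_top.2 hsurj)
    have hexp : ∀ v : Fin (m + 1) → ℝ, μ v = ∑ k, v k * μ (Pi.single k 1) := by
      intro v
      conv_lhs => rw [pi_eq_sum_univ' v]
      simp [map_sum, map_smul]
    have hker : ∀ x, ∑ k, L x k * μ (Pi.single k 1) = 0 := fun x => by
      rw [← hexp]
      exact hμ ⟨x, rfl⟩
    refine ⟨Fin.cons (μ (Pi.single 0 1)) fun j => -μ (Pi.single j.succ 1), fun h => hμ0 ?_,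
      fun i => ?_, fun j => ?_⟩
    · have hk : ∀ k, μ (Pi.single k 1) = 0 := by
        refine Fin.cases ?_ fun j => ?_
        · simpa using congrFun h 0
        · simpa using congrFun h j.succ
      exact LinearMap.ext fun v => by
        rw [hexp]
        simp [hk]
    · have := hker (Pi.single i 1, 0)
      rw [Fin.sum_univ_succ] at this
      simp only [hL0, hLs] at this
      simp [Pi.single_apply] at this
      simp only [Fin.cons_zero, Fin.cons_succ, neg_mul, Finset.sum_neg_distrib]
      rw [← sub_eq_zero, ← this]
      simp [mul_comm]
    · have := hker (0, Pi.single j 1)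
      rw [Fin.sum_univ_succ] at this
      simp only [hL0, hLs] at this
      simp [Pi.single_apply] at this
      simpa [mul_comm] using this

theorem exists_eval_hFJ_eq_zero {n m : ℕ} (f : MvPolynomial (Fin n) ℝ)
    (g : Fin m → MvPolynomial (Fin n) ℝ) (u : Fin n → ℝ)
    (hu : u ∈ Sg g) (hmin : ∀ x ∈ Sg g, eval u f ≤ eval x f) :
    ∃ z : Fin n ⊕ Fin (m + 1) → ℝ, z ∘ Sum.inl = u ∧ ∀ t, eval z (hFJ f g t) = 0 := by
  obtain ⟨lam, hne, h1, h2⟩ := exists_fritzJohn_multiplier f g u hu hmin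
  have hpos : 0 < ∑ k, lam k ^ 2 := by
    obtain ⟨k, hk⟩ := Function.ne_iff.1 hne
    exact Finset.sum_pos' (fun k _ => sq_nonneg _) ⟨k, Finset.mem_univ k, by
      have : lam k ≠ 0 := hk
      positivity⟩
  set r := Real.sqrt (∑ k, lam k ^ 2) with hr
  have hr2 : r ^ 2 = ∑ k, lam k ^ 2 := Real.sq_sqrt hpos.le
  have hz : (Sum.elim u fun k => lam k / r) ∘ Sum.inl = u := Sum.elim_comp_inl _ _
  refine ⟨Sum.elim u fun k => lam k / r, hz, ?_⟩
  rintro (i | j | _)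
  · simp only [hFJ, map_sub, map_sum, map_mul, eval_X, eval_rename, hz, Sum.elim_inr]
    simp only [div_mul_eq_mul_div, h1, ← Finset.sum_div, sub_self]
  · simp only [hFJ, map_mul, eval_X, eval_rename, hz, Sum.elim_inr, div_mul_eq_mul_div, h2,
      zero_div]
  · simp only [hFJ, map_sub, map_sum, map_one, map_pow, eval_X, Sum.elim_inr, div_pow,
      ← Finset.sum_div, hr2, div_self hpos.ne', sub_self]

end FritzJohnConditions

section Main

theorem InTruncQM.inQM {σ ι : Type*} [Fintype ι] {k : ℕ} {G : ι → MvPolynomial σ ℝ}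
    {p : MvPolynomial σ ℝ} (h : InTruncQM k G p) : InQM G p := by
  obtain ⟨s0, s, h0, hs, -, -, rfl⟩ := h
  exact ⟨s0, s, h0, hs, rfl⟩

theorem IsSOS.rename {σ τ : Type*} (e : σ → τ) {p : MvPolynomial σ ℝ} (hp : IsSOS p) :
    IsSOS (MvPolynomial.rename e p) := by
  obtain ⟨k, q, rfl⟩ := hp
  exact ⟨k, fun i => MvPolynomial.rename e (q i), by simp⟩

theorem InQM.rename {σ τ ι : Type*} [Fintype ι] (e : σ → τ) {G : ι → MvPolynomial σ ℝ}
    {p : MvPolynomial σ ℝ} (hp : InQM G p) :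
    InQM (fun j => MvPolynomial.rename e (G j)) (MvPolynomial.rename e p) := by
  obtain ⟨s0, s, h0, hs, rfl⟩ := hp
  exact ⟨_, fun j => MvPolynomial.rename e (s j), h0.rename e, fun j => (hs j).rename e,
    by simp⟩

theorem exists_rho_eq_of_neg_one_representation {σ ι κ : Type} [Finite σ] [Fintype ι]
    [Fintype κ] (F : MvPolynomial σ ℝ) (G : ι → MvPolynomial σ ℝ) (h : κ → MvPolynomial σ ℝ)
    (c : ℝ) (hfin : ((fun z => eval z F) '' {z | ∀ t, eval z (h t) = 0}).Finite)
    (hz : ∃ z, (∀ j, 0 ≤ eval z (G j)) ∧ (∀ t, eval z (h t) = 0) ∧ eval z F = c)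
    (hneg : ∀ t < c, ∃ τ, InQM G τ ∧
      -1 - τ ∈ Ideal.span (Set.range h) ⊔ Ideal.span {F - C t}) :
    ∃ k, rho k F G h = c := by
  obtain ⟨k, hk⟩ := exists_order_forall_pos F G h c hfin hneg
  obtain ⟨z, hzG, hzh, hzF⟩ := hz
  refine ⟨k, IsLUB.csSup_eq ⟨?_, fun b hb => ?_⟩ ⟨c - 1, hk 1 one_pos⟩⟩
  · rintro ξ ⟨q1, q2, h1, ⟨ψ, -, rfl⟩, he⟩
    have h2 := congrArg (eval z) he
    simp only [map_sub, map_add, map_sum, map_mul, hzh, hzF, eval_C, mul_zero,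
      Finset.sum_const_zero, add_zero] at h2
    linarith [h1.inQM.eval_nonneg hzG]
  · refine le_of_forall_pos_sub_le fun ε hε => hb (hk ε hε)

theorem X_mem_boundedElements {n m : ℕ} (f : MvPolynomial (Fin n) ℝ)
    (g : Fin m → MvPolynomial (Fin n) ℝ) (hg : ArchCond g)
    (I : Ideal (MvPolynomial (Fin n ⊕ Fin (m + 1)) ℝ)) (hI : ∀ t, hFJ f g t ∈ I)
    (i : Fin n ⊕ Fin (m + 1)) :
    X i ∈ (isQuadraticModule_inQM (fun j => rename Sum.inl (g j)) I).boundedElements := by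
  classical
  have hM := isQuadraticModule_inQM (fun j => rename Sum.inl (g j)) I
  obtain ⟨R, -, hR⟩ := hg
  rcases i with i | k
  · refine hM.mem_boundedElements_of_sub_sq_mem (R := R) ?_
    convert hM.add_mem ⟨_, hR.rename Sum.inl, by rw [sub_self]; exact I.zero_mem⟩
      (hM.sum_mem (Finset.univ.erase i) (fun i => X (Sum.inl i) ^ 2)
        fun i _ => hM.sq_mem _) using 1
    rw [map_sub, map_sum, rename_C, ← Finset.add_sum_erase _ _ (Finset.mem_univ i)]
    simp only [map_pow, rename_X, algebraMap_eq]
    ring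
  · refine hM.mem_boundedElements_of_sub_sq_mem (R := 1) ?_
    convert hM.add_mem ⟨0, IsSOS.inQM _ .zero, by rw [sub_zero]; exact hI (Sum.inr (Sum.inr ()))⟩
      (hM.sum_mem (Finset.univ.erase k) (fun i => X (Sum.inr i) ^ 2)
        fun i _ => hM.sq_mem _) using 1
    simp only [hFJ]
    rw [← Finset.add_sum_erase _ _ (Finset.mem_univ k), map_one]
    ring

end Main

/-- If problem `inf {f(x) : x ∈ S(g)}` has a global minimizer `u` (so `f* = f(u)`) and
`f(C(g))` is finite, then `ρ_k(f, Πg, h_FJ) = f*` for some `k`; moreover, if `S(g)`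
satisfies the Archimedean condition, then `ρ_k(f, g, h_FJ) = f*` for some `k`. -/
theorem exact_pop_FJ {n m : ℕ} (f : MvPolynomial (Fin n) ℝ)
    (g : Fin m → MvPolynomial (Fin n) ℝ) (u : Fin n → ℝ)
    (hu : u ∈ Sg g) (hmin : ∀ x ∈ Sg g, eval u f ≤ eval x f)
    (hfin : ((fun x => eval x f) '' Cset g).Finite) :
    (∃ k : ℕ, rho k (rename Sum.inl f) (PiG g) (hFJ f g) = eval u f) ∧
    (ArchCond g →
      ∃ k : ℕ, rho k (rename Sum.inl f) (fun j => rename Sum.inl (g j)) (hFJ f g)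
        = eval u f) := by
  classical
  obtain ⟨z₀, hz₀u, hz₀⟩ := exists_eval_hFJ_eq_zero f g u hu hmin
  have hz₀f : eval z₀ (rename Sum.inl f) = eval u f := by rw [eval_rename, hz₀u]
  have hz₀g : ∀ j, 0 ≤ eval z₀ (rename Sum.inl (g j)) := fun j => by
    rw [eval_rename, hz₀u]; exact hu j
  have hlt : ∀ t < eval u f, ∀ z : Fin n ⊕ Fin (m + 1) → ℝ,
      (∀ j, 0 ≤ eval z (rename Sum.inl (g j))) → eval z (rename Sum.inl f) ≠ t := by
    intro t ht z hzg hzf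
    rw [eval_rename] at hzf
    have := hmin (z ∘ Sum.inl) fun j => by rw [← eval_rename]; exact hzg j
    linarith
  refine ⟨?_, fun hA => ?_⟩
  · have hPi : PiG g = fun A : {A : Finset (Fin m) // A.Nonempty} =>
        ∏ j ∈ A.1, (rename Sum.inl (g j) : MvPolynomial (Fin n ⊕ Fin (m + 1)) ℝ) := by
      funext A
      simp [PiG]
    rw [hPi]
    refine exists_rho_eq_of_neg_one_representation _ _ _ _ (finite_image_eval_hFJ hfin)
      ⟨z₀, fun A => ?_, hz₀, hz₀f⟩ fun t ht => ?_
    · rw [map_prod]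
      exact Finset.prod_nonneg fun j _ => hz₀g j
    · obtain ⟨k, τ, hτ, h⟩ := exists_inQM_neg_pow_sub_mem
        (fun A : {A : Finset (Fin m) // A.Nonempty} =>
          ∏ j ∈ A.1, (rename Sum.inl (g j) : MvPolynomial (Fin n ⊕ Fin (m + 1)) ℝ))
        (Finset.univ.image (hFJ f g) ∪ {rename Sum.inl f - C t})
        (fun p q hp hq => hp.mul hq) 1 (fun z hz hzh => by
          refine absurd ?_ (hlt t ht z fun j => ?_)
          · have := hzh (rename Sum.inl f - C t) (by simp)
            rwa [map_sub, eval_C, sub_eq_zero] at this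
          · simpa using hz ⟨{j}, Finset.singleton_nonempty j⟩)
      refine ⟨τ, hτ, ?_⟩
      rw [← Ideal.span_union]
      simpa using h
  · refine exists_rho_eq_of_neg_one_representation _ _ _ _ (finite_image_eval_hFJ hfin)
      ⟨z₀, hz₀g, hz₀, hz₀f⟩ fun t ht => ?_
    refine exists_inQM_neg_one_sub_mem_of_bounded _ _
      (X_mem_boundedElements f g hA _ fun t => Ideal.mem_sup_left (Ideal.subset_span ⟨t, rfl⟩))
      fun z hzg hz => hlt t ht z hzg ?_
    have := hz (rename Sum.inl f - C t)
      (Ideal.mem_sup_right (Ideal.subset_span (Set.mem_singleton _)))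
    rwa [map_sub, eval_C, sub_eq_zero] at this
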